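/- Let Ω be a germ at a point x₀ of a differential 2-form of rank 4 on a 4-dimensional manifold which is of type 2. Then there exists a local coordinate system (x¹,x²,x³,x⁴) centred at x₀ in which Ω = exp((1+x¹)x³) dx¹∧dx² + dx³∧dx⁴. -/

import Mathlib

/-!  Coordinate formalization of differential forms in four variables,
     following "The equivalence problem of differential 2-forms in 4 variables". -/

open Real Filter

/-- Points of `ℝ⁴`; the coordinates `x¹, x², x³, x⁴` of the paper are `x 0, x 1, x 2, x 3`. -/
abbrev Pt := Fin 4 → ℝ

/-- Partial derivative `∂f/∂xⁱ`. -/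
noncomputable def pd (i : Fin 4) (f : Pt → ℝ) (x : Pt) : ℝ :=
  fderiv ℝ f x (Pi.single i 1)

/-- Second partial derivative `∂²f/∂xⁱ∂xʲ`. -/
noncomputable def pd2 (i j : Fin 4) (f : Pt → ℝ) (x : Pt) : ℝ :=
  pd i (fun y => pd j f y) x

/-- Differential forms of degree 0,1,2,3,4 on `ℝ⁴`, given by their (skew-symmetric)
    coordinate components, and vector fields. -/
abbrev Form0 := Pt → ℝ
abbrev Form1 := Pt → Fin 4 → ℝ
abbrev Form2 := Pt → Fin 4 → Fin 4 → ℝ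
abbrev Form3 := Pt → Fin 4 → Fin 4 → Fin 4 → ℝ
abbrev Form4 := Pt → Fin 4 → Fin 4 → Fin 4 → Fin 4 → ℝ
abbrev Vec := Pt → Fin 4 → ℝ

/-- A 2-form has skew-symmetric components. -/
def Alt2 (B : Form2) : Prop := ∀ x i j, B x i j = - B x j i

/-- Exterior derivative of a function. -/
noncomputable def d0 (f : Form0) : Form1 := fun x i => pd i f x

/-- Exterior derivative of a 1-form. -/
noncomputable def d1 (ω : Form1) : Form2 := fun x i j =>
  pd i (fun y => ω y j) x - pd j (fun y => ω y i) x

/-- Exterior derivative of a 2-form. -/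
noncomputable def d2 (B : Form2) : Form3 := fun x i j k =>
  pd i (fun y => B y j k) x - pd j (fun y => B y i k) x + pd k (fun y => B y i j) x

/-- Wedge product of two 1-forms. -/
def w11 (ω η : Form1) : Form2 := fun x i j => ω x i * η x j - ω x j * η x i

/-- Wedge product of a 1-form and a 2-form. -/
def w12 (ω : Form1) (B : Form2) : Form3 := fun x i j k =>
  ω x i * B x j k - ω x j * B x i k + ω x k * B x i j

/-- Wedge product of a 1-form and a 3-form. -/
def w13 (ω : Form1) (C : Form3) : Form4 := fun x i j k l =>
  ω x i * C x j k l - ω x j * C x i k l + ω x k * C x i j l - ω x l * C x i j k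

/-- Wedge product of two 2-forms. -/
def w22 (A B : Form2) : Form4 := fun x i j k l =>
  A x i j * B x k l - A x i k * B x j l + A x i l * B x j k
    + A x j k * B x i l - A x j l * B x i k + A x k l * B x i j

/-- A 2-form is of rank 4 when `Ω ∧ Ω` vanishes nowhere. -/
def Rank4 (B : Form2) : Prop := ∀ x, w22 B B x ≠ 0

/-- Interior products `i_X`. -/
def i1 (X : Vec) (ω : Form1) : Form0 := fun x => ∑ i, X x i * ω x i
def i2 (X : Vec) (B : Form2) : Form1 := fun x j => ∑ i, X x i * B x i j
def i3 (X : Vec) (C : Form3) : Form2 := fun x j k => ∑ i, X x i * C x i j k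
def i4 (X : Vec) (D : Form4) : Form3 := fun x j k l => ∑ i, X x i * D x i j k l

/-- Evaluation `B(X,Y)` of a 2-form on two vector fields. -/
def ev2 (B : Form2) (X Y : Vec) : Form0 := fun x => ∑ i, ∑ j, X x i * Y x j * B x i j

/-- Evaluation `D(X,Y,Z,W)` of a 4-form on four vector fields. -/
def ev4 (D : Form4) (X Y Z W : Vec) : Form0 := fun x =>
  ∑ i, ∑ j, ∑ k, ∑ l, X x i * Y x j * Z x k * W x l * D x i j k l

/-- Lie derivative of a 1-form (Cartan's magic formula). -/
noncomputable def lie1 (X : Vec) (ω : Form1) : Form1 := fun x i =>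
  d0 (i1 X ω) x i + i2 X (d1 ω) x i

/-- Lie derivative of a 2-form (Cartan's magic formula). -/
noncomputable def lie2 (X : Vec) (B : Form2) : Form2 := fun x i j =>
  d1 (i2 X B) x i j + i3 X (d2 B) x i j

/-- Lie bracket of two vector fields. -/
noncomputable def bracket (X Y : Vec) : Vec := fun x i =>
  ∑ j, (X x j * pd j (fun y => Y y i) x - Y x j * pd j (fun y => X y i) x)

/-- Derivative `X(f)` of a function along a vector field. -/
noncomputable def dirDeriv (X : Vec) (f : Form0) : Form0 := fun x => ∑ j, X x j * pd j f x

/-- Pullback of a 1-form under a smooth map. -/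
noncomputable def pull1 (φ : Pt → Pt) (ω : Form1) : Form1 := fun x i =>
  ∑ a, ω (φ x) a * pd i (fun y => φ y a) x

/-- Pullback of a 2-form under a smooth map. -/
noncomputable def pull2 (φ : Pt → Pt) (B : Form2) : Form2 := fun x i j =>
  ∑ a, ∑ b, B (φ x) a b * pd i (fun y => φ y a) x * pd j (fun y => φ y b) x

/-- A pair of mutually inverse smooth maps: a diffeomorphism of `ℝ⁴` (with inverse). -/
def IsDiffeo (φ ψ : Pt → Pt) : Prop :=
  ContDiff ℝ (⊤ : ℕ∞) φ ∧ ContDiff ℝ (⊤ : ℕ∞) ψ ∧ (∀ x, ψ (φ x) = x) ∧ (∀ x, φ (ψ x) = x)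

/-- The covector with components `c` as a linear functional on the tangent space `ℝ⁴`. -/
noncomputable def covec (c : Fin 4 → ℝ) : Pt →ₗ[ℝ] ℝ :=
  ∑ i, c i • (LinearMap.proj i : Pt →ₗ[ℝ] ℝ)

/-- The class of a 1-form `ω` at `x`: the codimension of the space of tangent vectors `v`
    with `i_v ω = 0` and `i_v (dω) = 0`. -/
noncomputable def classAt (ω : Form1) (x : Pt) : ℕ :=
  4 - Module.finrank ℝ
    ↥(LinearMap.ker (covec (ω x)) ⊓ ⨅ j, LinearMap.ker (covec (fun i => d1 ω x i j)))

/-- Components of the constant 2-form `dxᵃ ∧ dxᵇ`. -/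
def dxw (a b : Fin 4) : Fin 4 → Fin 4 → ℝ := fun i j =>
  (if i = a ∧ j = b then (1:ℝ) else 0) - (if i = b ∧ j = a then (1:ℝ) else 0)

/-- A germ of 2-form (with associated 1-form `ω = ω_Ω`) is of type `t` at `x₀`:
    `ω` is nonsingular at `x₀` and of constant class `t` near `x₀`. -/
def IsTypeAt (ω : Form1) (t : ℕ) (x₀ : Pt) : Prop :=
  ω x₀ ≠ 0 ∧ ∀ᶠ x in nhds x₀, classAt ω x = t

section Part1
open Real Filter
open scoped ContDiff Topology

section Nem
set_option linter.unusedSectionVars false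
variable {X : Type} [TopologicalSpace X] [CompactSpace X]
variable {E F : Type} [NormedAddCommGroup E] [NormedSpace ℝ E] [NormedAddCommGroup F] [NormedSpace ℝ F]

/-- Pointwise application of a continuous family of linear maps. -/
noncomputable def ptApply (X E F : Type) [TopologicalSpace X] [CompactSpace X]
    [NormedAddCommGroup E] [NormedSpace ℝ E] [NormedAddCommGroup F] [NormedSpace ℝ F] :
    C(X, E →L[ℝ] F) →L[ℝ] C(X, E) →L[ℝ] C(X, F) :=
  LinearMap.mkContinuous₂
    (LinearMap.mk₂ ℝ (fun (A : C(X, E →L[ℝ] F)) (g : C(X, E)) =>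
        (⟨fun x => A x (g x), by fun_prop⟩ : C(X, F)))
      (by intros; ext; simp) (by intros; ext; simp) (by intros; ext; simp) (by intros; ext; simp))
    1 (by
      intro A g
      rw [one_mul, ContinuousMap.norm_le _ (by positivity)]
      intro x
      refine ((A x).le_opNorm (g x)).trans ?_
      gcongr
      · exact A.norm_coe_le_norm x
      · exact g.norm_coe_le_norm x)

@[simp] lemma ptApply_apply (A : C(X, E →L[ℝ] F)) (g : C(X, E)) (x : X) :
    ptApply X E F A g x = A x (g x) := rfl

/-- Composition operator. -/
def nem (f : E → F) (hf : Continuous f) (g : C(X, E)) : C(X, F) := ⟨fun x => f (g x), by fun_prop⟩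

@[simp] lemma nem_apply (f : E → F) (hf : Continuous f) (g : C(X, E)) (x : X) :
    nem f hf g x = f (g x) := rfl

lemma nem_continuous (f : E → F) (hf : Continuous f) :
    Continuous (nem f hf : C(X, E) → C(X, F)) :=
  ContinuousMap.continuous_postcomp (⟨f, hf⟩ : C(E, F))

lemma nem_hasFDerivAt (f : E → F) (hf : ContDiff ℝ 1 f) (g : C(X, E)) :
    HasFDerivAt (nem f hf.continuous : C(X, E) → C(X, F))
      (ptApply X E F (nem (fderiv ℝ f) (hf.continuous_fderiv one_ne_zero) g)) g := by
  rw [hasFDerivAt_iff_isLittleO_nhds_zero, Asymptotics.isLittleO_iff]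
  intro c hc
  have hcont := (nem_continuous (X := X) (fderiv ℝ f) (hf.continuous_fderiv one_ne_zero)).tendsto g
  rw [Metric.tendsto_nhds_nhds] at hcont
  obtain ⟨δ, hδ, H⟩ := hcont c hc
  filter_upwards [Metric.ball_mem_nhds (0 : C(X, E)) hδ] with h hh
  rw [mem_ball_zero_iff] at hh
  rw [ContinuousMap.norm_le _ (by positivity)]
  intro x
  have key := (convex_segment (𝕜 := ℝ) (g x) (g x + h x)).norm_image_sub_le_of_norm_hasFDerivWithin_le'
    (f := f) (f' := fderiv ℝ f) (φ := fderiv ℝ f (g x)) (C := c) (x := g x) (y := g x + h x)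
    (fun z _ => ((hf.differentiable one_ne_zero) z).hasFDerivAt.hasFDerivWithinAt) ?_
    (left_mem_segment ..) (right_mem_segment ..)
  · simp only [ContinuousMap.sub_apply, nem_apply, ContinuousMap.add_apply, ptApply_apply]
    rw [add_sub_cancel_left] at key
    refine key.trans ?_
    gcongr
    exact h.norm_coe_le_norm x
  · intro z hz
    rw [segment_eq_image'] at hz
    obtain ⟨t, ht, rfl⟩ := hz
    have h1 : dist (g + t • h) g < δ := by
      rw [dist_eq_norm, add_sub_cancel_left, norm_smul, Real.norm_of_nonneg ht.1]
      refine lt_of_le_of_lt ?_ hh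
      exact mul_le_of_le_one_left (norm_nonneg _) ht.2
    have h2 := H h1
    rw [dist_eq_norm] at h2
    have h3 := (ContinuousMap.norm_coe_le_norm _ x).trans h2.le
    simpa using h3

lemma nem_contDiff_nat (n : ℕ) : ∀ {F : Type} [NormedAddCommGroup F] [NormedSpace ℝ F]
    (f : E → F) (hf : ContDiff ℝ n f), ContDiff ℝ n (nem f hf.continuous : C(X, E) → C(X, F)) := by
  induction n with
  | zero =>
    intro F _ _ f hf
    exact contDiff_zero.2 (nem_continuous f hf.continuous)
  | succ n ih =>
    intro F _ _ f hf
    have hf1 : ContDiff ℝ 1 f := hf.of_le (by norm_cast; omega)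
    have hd : ContDiff ℝ n (fderiv ℝ f) := hf.fderiv_right (by norm_cast)
    have : ((n + 1 : ℕ) : WithTop ℕ∞) = (n : WithTop ℕ∞) + 1 := by norm_cast
    suffices h : ∀ m : WithTop ℕ∞, m = n + 1 →
        ContDiff ℝ m (nem f hf1.continuous : C(X, E) → C(X, F)) from h _ this
    rintro m rfl
    rw [contDiff_succ_iff_hasFDerivAt]
    · refine ⟨_, ?_, fun g => nem_hasFDerivAt f hf1 g⟩
      exact (ptApply X E F).contDiff.comp (ih (fderiv ℝ f) hd)

lemma nem_contDiff (f : E → F) (hf : ContDiff ℝ ∞ f) :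
    ContDiff ℝ ∞ (nem f hf.continuous : C(X, E) → C(X, F)) := by
  rw [contDiff_infty]
  intro n
  exact nem_contDiff_nat n f (hf.of_le (by exact_mod_cast le_top))

end Nem

section Inv
variable {E F : Type*} [NormedAddCommGroup E] [NormedSpace ℝ E] [NormedAddCommGroup F]
  [NormedSpace ℝ F] [CompleteSpace E]

lemma inv_fun (f : E → F) (x₀ : E) (S : Set E) (hS : S ∈ 𝓝 x₀)
    (hf : ∀ᶠ x in 𝓝 x₀, ContDiffAt ℝ ∞ f x) (f' : E ≃L[ℝ] F)
    (hf' : HasFDerivAt f (f' : E →L[ℝ] F) x₀) :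
    ∃ e : OpenPartialHomeomorph E F, (∀ x, e x = f x) ∧ x₀ ∈ e.source ∧ e.source ⊆ S ∧
      (∀ x ∈ e.source, ContDiffAt ℝ ∞ f x) ∧ (∀ y ∈ e.target, ContDiffAt ℝ ∞ e.symm y) := by
  have h0 : ContDiffAt ℝ ∞ f x₀ := hf.self_of_nhds
  have hne : (∞ : WithTop ℕ∞) ≠ 0 := by simp
  let e₀ := h0.toOpenPartialHomeomorph f hf' hne
  have hr : ∀ᶠ x in 𝓝 x₀, fderiv ℝ f x ∈ Set.range ((↑) : (E ≃L[ℝ] F) → E →L[ℝ] F) := by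
    have hc : ContinuousAt (fderiv ℝ f) x₀ := (h0.fderiv_right (m := 0) (by simp)).continuousAt
    apply hc.eventually
    rw [hf'.fderiv]
    exact ContinuousLinearEquiv.nhds f'
  obtain ⟨s, hs, hso, hxs⟩ := eventually_nhds_iff.1 ((hf.and hr).and hS)
  refine ⟨e₀.restrOpen s hso, fun x => rfl, ?_, ?_, ?_, ?_⟩
  · exact ⟨h0.mem_toOpenPartialHomeomorph_source hf' hne, hxs⟩
  · exact fun x hx => (hs x hx.2).2
  · exact fun x hx => (hs x hx.2).1.1
  · intro y hy
    have hx := (e₀.restrOpen s hso).map_target hy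
    obtain ⟨⟨h1, ⟨g, hg⟩⟩, -⟩ := hs _ hx.2
    refine OpenPartialHomeomorph.contDiffAt_symm _ (f₀' := g) hy ?_ h1
    rw [hg]
    exact (h1.differentiableAt hne).hasFDerivAt

end Inv

/-- Smooth cutoff extension -/
lemma exists_ext {E F : Type*} [NormedAddCommGroup E] [NormedSpace ℝ E] [FiniteDimensional ℝ E]
    [NormedAddCommGroup F] [NormedSpace ℝ F] (f : E → F) (x₀ : E)
    (hf : ∀ᶠ x in 𝓝 x₀, ContDiffAt ℝ ∞ f x) :
    ∃ g : E → F, ContDiff ℝ ∞ g ∧ g =ᶠ[𝓝 x₀] f := by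
  obtain ⟨ε, hε, hb⟩ := Metric.eventually_nhds_iff_ball.1 hf
  let b : ContDiffBump x₀ := ⟨ε/4, ε/2, by positivity, by linarith⟩
  refine ⟨fun x => b x • f x, ?_, ?_⟩
  · rw [contDiff_iff_contDiffAt]
    intro x
    by_cases hx : x ∈ Metric.ball x₀ ε
    · exact b.contDiff.contDiffAt.smul (hb x hx)
    · have : (fun x => b x • f x) =ᶠ[𝓝 x] fun _ => 0 := by
        have hx' : (Metric.closedBall x₀ (ε/2))ᶜ ∈ 𝓝 x := by
          apply Metric.isClosed_closedBall.isOpen_compl.mem_nhds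
          simp only [Metric.mem_ball, not_lt, Set.mem_compl_iff, Metric.mem_closedBall, not_le] at *
          linarith
        filter_upwards [hx'] with y hy
        simp only [Set.mem_compl_iff, Metric.mem_closedBall, not_le] at hy
        rw [b.zero_of_le_dist hy.le, zero_smul]
      exact contDiffAt_const.congr_of_eventuallyEq this
  · filter_upwards [b.eventuallyEq_one] with y hy
    simp [hy]

end Part1

section Part2
open Real Filter
open scoped ContDiff Topology unitInterval

section IntOp
set_option linter.unusedSectionVars false
variable {E : Type} [NormedAddCommGroup E] [NormedSpace ℝ E] [CompleteSpace E]

/-- Extension of a path to the line. -/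
noncomputable def extI {E : Type} (f : I → E) : ℝ → E := Set.IccExtend (zero_le_one (α := ℝ)) f

lemma extI_cont (f : C(I, E)) : Continuous (extI f) := f.continuous.Icc_extend'

lemma extI_of (f : I → E) (t : I) : extI f t = f t := Set.IccExtend_val _ _ _

/-- Antiderivative operator on paths. -/
noncomputable def intOp (E : Type) [NormedAddCommGroup E] [NormedSpace ℝ E] [CompleteSpace E] :
    C(I, E) →L[ℝ] C(I, E) :=
  LinearMap.mkContinuous
    { toFun := fun f => (⟨fun t => ∫ s in (0:ℝ)..t, extI f s, by
          have h : Continuous fun t : ℝ => ∫ s in (0:ℝ)..t, extI f s :=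
            intervalIntegral.continuous_primitive
              (fun a b => (extI_cont f).intervalIntegrable a b) 0
          exact h.comp continuous_subtype_val⟩ : C(I, E))
      map_add' := by
        intro f g
        ext t
        simp only [ContinuousMap.coe_mk, ContinuousMap.add_apply]
        rw [← intervalIntegral.integral_add ((extI_cont f).intervalIntegrable _ _)
          ((extI_cont g).intervalIntegrable _ _)]
        rfl
      map_smul' := by
        intro c f
        ext t
        simp only [ContinuousMap.coe_mk, ContinuousMap.smul_apply, RingHom.id_apply]
        rw [← intervalIntegral.integral_smul]
        rfl }
    1 (by
      intro f
      rw [one_mul, ContinuousMap.norm_le _ (by positivity)]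
      intro t
      have := intervalIntegral.norm_integral_le_of_norm_le_const (a := 0) (b := (t : ℝ))
        (f := extI f) (C := ‖f‖) (fun s _ => f.norm_coe_le_norm _)
      refine this.trans ?_
      rw [sub_zero, abs_of_nonneg t.2.1]
      exact mul_le_of_le_one_right (norm_nonneg _) t.2.2)

lemma intOp_apply (f : C(I, E)) (t : I) : intOp E f t = ∫ s in (0:ℝ)..t, extI f s := rfl

lemma intOp_deriv (f : C(I, E)) (t : ℝ) :
    HasDerivAt (fun t : ℝ => ∫ s in (0:ℝ)..t, extI f s) (extI f t) t :=
  intervalIntegral.integral_hasDerivAt_right ((extI_cont f).intervalIntegrable _ _)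
    (extI_cont f).stronglyMeasurable.stronglyMeasurableAtFilter (extI_cont f).continuousAt

/-- Constant paths. -/
noncomputable def cst (E : Type) [NormedAddCommGroup E] [NormedSpace ℝ E] : E →L[ℝ] C(I, E) :=
  LinearMap.mkContinuous
    { toFun := fun x => ContinuousMap.const I x
      map_add' := by intros; ext; simp
      map_smul' := by intros; ext; simp } 1 (by
      intro x
      rw [one_mul, ContinuousMap.norm_le _ (by positivity)]
      intro t
      simp)

@[simp] lemma cst_apply (x : E) (t : I) : cst E x t = x := rfl

/-- Evaluation of paths. -/
noncomputable def evI (E : Type) [NormedAddCommGroup E] [NormedSpace ℝ E] (t : I) : C(I, E) →L[ℝ] E :=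
  ContinuousMap.evalCLM ℝ t

@[simp] lemma evI_apply (f : C(I, E)) (t : I) : evI E t f = f t := rfl

lemma ode_family (A : E → E →L[ℝ] E) (hA : ContDiff ℝ ∞ A) (x₀ : E) (L : E →L[ℝ] E) :
    ∃ γ : E → C(I, E), γ 0 = cst E x₀ ∧ ∀ᶠ x in 𝓝 (0 : E), ContDiffAt ℝ ∞ γ x ∧
      γ x = cst E (x₀ + L x) + intOp E (ptApply I E E (nem A hA.continuous (γ x)) (cst E x)) := by
  let N : C(I, E) → C(I, E →L[ℝ] E) := nem A hA.continuous
  have hN : ContDiff ℝ ∞ N := nem_contDiff A hA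
  let Φ : E × C(I, E) → C(I, E) := fun z =>
    z.2 - (cst E (x₀ + L z.1) + intOp E (ptApply I E E (N z.2) (cst E z.1)))
  have hΦ : ContDiff ℝ ∞ Φ := by fun_prop
  let T : E × C(I, E) → E × C(I, E) := fun z => (z.1, Φ z)
  have hT : ContDiff ℝ ∞ T := by fun_prop
  let z₀ : E × C(I, E) := (0, cst E x₀)
  have hΦ0 : Φ z₀ = 0 := by simp [Φ, z₀]
  let B : E →L[ℝ] C(I, E) := (cst E).comp L + (intOp E).comp ((ptApply I E E (N (cst E x₀))).comp (cst E))
  have hderΦ : HasFDerivAt Φ (ContinuousLinearMap.snd ℝ E C(I, E)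
      - B.comp (ContinuousLinearMap.fst ℝ E C(I, E))) z₀ := by
    have h1 : HasFDerivAt (fun z : E × C(I, E) => z.1) (ContinuousLinearMap.fst ℝ E C(I, E)) z₀ := hasFDerivAt_fst
    have h2 : HasFDerivAt (fun z : E × C(I, E) => z.2) (ContinuousLinearMap.snd ℝ E C(I, E)) z₀ := hasFDerivAt_snd
    have hN2 := ((show ContDiff ℝ ∞ (fun z : E × C(I, E) => ptApply I E E (N z.2)) by
      fun_prop).differentiable (by simp) z₀).hasFDerivAt
    have hp := hN2.clm_apply ((cst E).hasFDerivAt.comp z₀ h1)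
    have hq := (intOp E).hasFDerivAt.comp z₀ hp
    have hl := (cst E).hasFDerivAt.comp z₀ ((L.hasFDerivAt.comp z₀ h1).const_add x₀)
    have := h2.sub (hl.add hq)
    refine this.congr_fderiv ?_
    ext v
    · simp [B, z₀]
    · simp [B, z₀]
  let f' : (E × C(I, E)) ≃L[ℝ] (E × C(I, E)) :=
    ContinuousLinearEquiv.skewProd (ContinuousLinearEquiv.refl ℝ E) (ContinuousLinearEquiv.refl ℝ C(I, E)) (-B)
  have hT' : HasFDerivAt T (f' : (E × C(I, E)) →L[ℝ] (E × C(I, E))) z₀ := by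
    refine (hasFDerivAt_fst.prodMk hderΦ).congr_fderiv ?_
    ext v <;> simp [f', sub_eq_add_neg]
  obtain ⟨e, he, hz, -, -, hsm⟩ := inv_fun T z₀ Set.univ Filter.univ_mem
    (Eventually.of_forall fun z => hT.contDiffAt) f' hT'
  have hTz : T z₀ = ((0 : E), (0 : C(I, E))) := by simp only [T, hΦ0]; rfl
  have hmem : ((0 : E), (0 : C(I, E))) ∈ e.target := by
    rw [← hTz, ← he]; exact e.map_source hz
  refine ⟨fun x => (e.symm (x, 0)).2, ?_, ?_⟩
  · simp only
    rw [← hTz, ← he, e.left_inv hz]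
  · have hc : Continuous fun x : E => (x, (0 : C(I, E))) := by fun_prop
    have : ∀ᶠ x in 𝓝 (0 : E), (x, (0 : C(I, E))) ∈ e.target :=
      hc.continuousAt.eventually (e.open_target.mem_nhds hmem)
    filter_upwards [this] with x hx
    constructor
    · exact contDiffAt_snd.comp x (ContDiffAt.comp x (hsm _ hx) (by fun_prop))
    · have h := e.right_inv hx
      rw [he] at h
      have h1 : (e.symm (x, 0)).1 = x := congrArg Prod.fst h
      have h2 : Φ (e.symm (x, 0)) = 0 := congrArg Prod.snd h
      simp only [Φ, h1] at h2
      exact sub_eq_zero.1 h2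

end IntOp

end Part2

section Part3
open Real Filter
open scoped ContDiff Topology unitInterval

section Frob
set_option linter.unusedSectionVars false
variable {E : Type} [NormedAddCommGroup E] [NormedSpace ℝ E] [FiniteDimensional ℝ E] [CompleteSpace E]

/-- Exterior derivative of a 1-form, invariantly. -/
noncomputable def dform (η : E → E →L[ℝ] ℝ) (x X Y : E) : ℝ :=
  fderiv ℝ η x X Y - fderiv ℝ η x Y X

/-- Frobenius integrability at a point. -/
def Integ (η : E → E →L[ℝ] ℝ) (x : E) : Prop :=
  ∀ X Y Z : E, dform η x X Y * η x Z + dform η x Y Z * η x X + dform η x Z X * η x Y = 0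

lemma frob_ode (η : E → E →L[ℝ] ℝ) (hη : ContDiff ℝ ∞ η) (e : E)
    (c d V V' : C(I, E)) (c₀ : E)
    (hc : c = cst E c₀ + intOp E d) (hV : V = intOp E V')
    (hInteg : ∀ t, Integ η (c t)) (he : ∀ t, η (c t) e ≠ 0)
    (hd : ∀ t, η (c t) (d t) = 0)
    (hV' : ∀ t, fderiv ℝ η (c t) (V t) (d t) + η (c t) (V' t) = 0) (t : I) :
    η (c t) (V t) = 0 := by
  let cc : ℝ → E := fun t => c₀ + ∫ s in (0:ℝ)..t, extI d s
  let VV : ℝ → E := fun t => ∫ s in (0:ℝ)..t, extI V' s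
  have hcc : ∀ t : I, cc t = c t := by intro t; rw [hc]; simp [cc, intOp_apply]
  have hVV : ∀ t : I, VV t = V t := by intro t; rw [hV]; simp [VV, intOp_apply]
  have dcc : ∀ t, HasDerivAt cc (extI d t) t := fun t => (intOp_deriv d t).const_add c₀
  have dVV : ∀ t, HasDerivAt VV (extI V' t) t := fun t => intOp_deriv V' t
  have hηd : ∀ x, HasFDerivAt η (fderiv ℝ η x) x :=
    fun x => (hη.differentiable (by simp) x).hasFDerivAt
  let θ : ℝ → ℝ := fun t => η (cc t) (VV t)
  have dθ : ∀ t, HasDerivAt θ (fderiv ℝ η (cc t) (extI d t) (VV t) + η (cc t) (extI V' t)) t := by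
    intro t
    exact ((hηd (cc t)).comp_hasDerivAt t (dcc t)).clm_apply (dVV t)
  have hη' : Continuous (fderiv ℝ η) := hη.continuous_fderiv (by simp)
  let k : C(I, ℝ) := ⟨fun t => - (dform η (c t) e (d t) / η (c t) e), by
    unfold dform
    have h1 : Continuous fun t => η (c t) e := by
      have := hη.continuous
      fun_prop
    refine (Continuous.div ?_ h1 he).neg
    fun_prop⟩
  have key := eq_zero_of_abs_deriv_le_mul_abs_self_of_eq_zero_right (f := θ)
    (f' := fun t => fderiv ℝ η (cc t) (extI d t) (VV t) + η (cc t) (extI V' t)) (K := ‖k‖)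
    (a := 0) (b := 1) (fun t _ => (dθ t).continuousAt.continuousWithinAt)
    (fun t _ => (dθ t).hasDerivWithinAt) (by simp [θ, VV]) ?_ t t.2
  · simpa [θ, hcc, hVV] using key
  · intro s hs
    obtain ⟨s, rfl⟩ : ∃ s' : I, (s' : ℝ) = s := ⟨⟨s, hs.1, hs.2.le⟩, rfl⟩
    have h1 : fderiv ℝ η (c s) (d s) (V s) + η (c s) (V' s) = k s * η (c s) (V s) := by
      have h2 := hInteg s (d s) (V s) e
      rw [hd s] at h2
      have h3 := hV' s
      have h4 : k s = - (dform η (c s) e (d s) / η (c s) e) := rfl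
      rw [h4]
      have h5 := he s
      have h6 : fderiv ℝ η (c s) (d s) (V s) + η (c s) (V' s) = dform η (c s) (d s) (V s) := by
        unfold dform; linarith
      rw [h6]
      field_simp
      linarith
    simp only [θ, hcc, hVV, extI_of]
    rw [h1, norm_mul]
    gcongr
    exact k.norm_coe_le_norm s

lemma frob_main (η : E → E →L[ℝ] ℝ) (hη : ContDiff ℝ ∞ η) (x₀ : E) (h0 : η x₀ ≠ 0)
    (hInteg : ∀ᶠ x in 𝓝 x₀, Integ η x) :
    ∃ p q : E → ℝ, (∀ᶠ x in 𝓝 x₀, ContDiffAt ℝ ∞ p x) ∧ (∀ᶠ x in 𝓝 x₀, ContDiffAt ℝ ∞ q x) ∧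
      p x₀ = 1 ∧ q x₀ = 0 ∧ ∀ᶠ x in 𝓝 x₀, η x = p x • fderiv ℝ q x := by
  obtain ⟨e, he⟩ : ∃ e, η x₀ e = 1 := by
    obtain ⟨v, hv⟩ : ∃ v, η x₀ v ≠ 0 := by
      by_contra! h
      exact h0 (ContinuousLinearMap.ext h)
    exact ⟨(η x₀ v)⁻¹ • v, by simp [hv]⟩
  have hηe : ContDiff ℝ ∞ fun x => η x e := by fun_prop
  have hne : ∀ᶠ x in 𝓝 x₀, η x e ≠ 0 :=
    hηe.continuous.continuousAt.eventually_ne (by rw [he]; exact one_ne_zero)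
  let A₀ : E → E →L[ℝ] E := fun x =>
    ContinuousLinearMap.id ℝ E - (η x e)⁻¹ • (η x).smulRight e
  have hA₀ : ∀ᶠ x in 𝓝 x₀, ContDiffAt ℝ ∞ A₀ x := by
    filter_upwards [hne] with x hx
    have h1 : ContDiffAt ℝ ∞ (fun x => (η x e)⁻¹) x := hηe.contDiffAt.inv hx
    have h2 : ContDiff ℝ ∞ (fun x => (η x).smulRight e) := by fun_prop
    exact contDiffAt_const.sub (h1.smul h2.contDiffAt)
  obtain ⟨A, hA, hAA⟩ := exists_ext A₀ x₀ hA₀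
  have hAx₀ : A x₀ = A₀ x₀ := hAA.self_of_nhds
  have hηA : ∀ᶠ x in 𝓝 x₀, ∀ v, η x (A x v) = 0 := by
    filter_upwards [hne, hAA] with x hx hx2 v
    rw [hx2]
    simp [A₀]
    field_simp
    simp
  let L : E →L[ℝ] E := (η x₀).smulRight e
  obtain ⟨γ, hγ0, hγ⟩ := ode_family A hA x₀ L
  let δ : E → C(I, E) := fun x => ptApply I E E (nem A hA.continuous (γ x)) (cst E x)
  have hN : ContDiff ℝ ∞ (nem A hA.continuous : C(I, E) → C(I, E →L[ℝ] E)) := nem_contDiff A hA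
  have hP : ContDiff ℝ ∞ (fun c : C(I, E) => ptApply I E E (nem A hA.continuous c)) := by fun_prop
  obtain ⟨ε, hε, hS⟩ := Metric.eventually_nhds_iff_ball.1 ((hInteg.and hne).and hηA)
  have hγc : ContinuousAt γ 0 := hγ.self_of_nhds.1.continuousAt
  have hball : ∀ᶠ x in 𝓝 (0 : E), ∀ t, γ x t ∈ Metric.ball x₀ ε := by
    have := hγc.eventually (Metric.ball_mem_nhds _ hε)
    filter_upwards [this] with x hx t
    rw [hγ0] at hx
    exact lt_of_le_of_lt (ContinuousMap.dist_apply_le_dist t) hx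
  have hgood := (hγ.and hball).eventually_nhds
  let Γ : E → E := fun x => γ x 1
  have hΓs : ∀ᶠ x in 𝓝 (0 : E), ContDiffAt ℝ ∞ Γ x := by
    filter_upwards [hγ] with x hx
    exact (evI E 1).contDiff.contDiffAt.comp x hx.1
  have hΓ0 : Γ 0 = x₀ := by simp [Γ, hγ0]
  have hmain : ∀ᶠ x in 𝓝 (0 : E), ∀ v, η x₀ v = 0 → η (Γ x) (fderiv ℝ Γ x v) = 0 := by
    filter_upwards [hgood] with x hx v hv
    have hx1 := hx.self_of_nhds
    have hγd : HasFDerivAt γ (fderiv ℝ γ x) x := (hx1.1.1.differentiableAt (by simp)).hasFDerivAt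
    have hδs : ContDiffAt ℝ ∞ δ x := by
      have h1 : ContDiffAt ℝ ∞ (fun x => ptApply I E E (nem A hA.continuous (γ x))) x :=
        hP.contDiffAt.comp x hx1.1.1
      exact h1.clm_apply (cst E).contDiff.contDiffAt
    have hδd : HasFDerivAt δ (fderiv ℝ δ x) x := (hδs.differentiableAt (by simp)).hasFDerivAt
    have hVeq : fderiv ℝ γ x v = intOp E (fderiv ℝ δ x v) := by
      have h1 : γ =ᶠ[𝓝 x] fun y => cst E (x₀ + L y) + intOp E (δ y) := by
        filter_upwards [hx] with y hy using hy.1.2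
      have h2 : HasFDerivAt (fun y => cst E (x₀ + L y) + intOp E (δ y))
          ((cst E).comp L + (intOp E).comp (fderiv ℝ δ x)) x := by
        have ha : HasFDerivAt (fun y => cst E (x₀ + L y)) ((cst E).comp L) x :=
          (cst E).hasFDerivAt.comp x (L.hasFDerivAt.const_add x₀)
        exact ha.add ((intOp E).hasFDerivAt.comp x hδd)
      rw [h1.fderiv_eq, h2.fderiv]
      simp [L, hv]
    have hfin := frob_ode η hη e (γ x) (δ x) (fderiv ℝ γ x v) (fderiv ℝ δ x v) (x₀ + L x)
      hx1.1.2 hVeq (fun t => (hS _ (hx1.2 t)).1.1) (fun t => (hS _ (hx1.2 t)).1.2)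
      (fun t => (hS _ (hx1.2 t)).2 x) ?_ 1
    · have hΓd : HasFDerivAt Γ ((evI E 1).comp (fderiv ℝ γ x)) x :=
        (evI E 1).hasFDerivAt.comp x hγd
      rw [hΓd.fderiv]
      exact hfin
    · intro t
      have h1 : (fun y => η (γ y t) (δ y t)) =ᶠ[𝓝 x] fun _ => 0 := by
        filter_upwards [hx] with y hy
        exact (hS _ (hy.2 t)).2 y
      have ha : HasFDerivAt (fun y => γ y t) ((evI E t).comp (fderiv ℝ γ x)) x :=
        (evI E t).hasFDerivAt.comp x hγd
      have hb : HasFDerivAt (fun y => δ y t) ((evI E t).comp (fderiv ℝ δ x)) x :=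
        (evI E t).hasFDerivAt.comp x hδd
      have hηd : HasFDerivAt η (fderiv ℝ η (γ x t)) (γ x t) :=
        (hη.differentiable (by simp) _).hasFDerivAt
      have hcd := (HasFDerivAt.comp (g := η) x hηd ha).clm_apply hb
      have h2 := hcd.unique ((hasFDerivAt_const (0:ℝ) x).congr_of_eventuallyEq h1)
      have h3 := congrArg (fun l => l v) h2
      simp at h3
      linarith
  have hΓd : HasFDerivAt Γ ((ContinuousLinearEquiv.refl ℝ E : E ≃L[ℝ] E) : E →L[ℝ] E) 0 := by
    have h0' := hγ.self_of_nhds.1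
    have h1 : Γ =ᶠ[𝓝 0] fun x => x₀ + L x + evI E 1 (intOp E (δ x)) := by
      filter_upwards [hγ] with x hx
      have := congrArg (evI E 1) hx.2
      simpa [Γ] using this
    have h1d : HasFDerivAt (fun x => ptApply I E E (nem A hA.continuous (γ x))) _ 0 :=
      ((hP.contDiffAt.comp 0 h0').differentiableAt
        (by simp)).hasFDerivAt
    have h2 := h1d.clm_apply ((cst E).hasFDerivAt (x := 0))
    have h3 := (L.hasFDerivAt (x := 0)).const_add x₀ |>.add
      ((evI E 1).hasFDerivAt.comp 0 ((intOp E).hasFDerivAt.comp 0 h2))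
    refine (h3.congr_of_eventuallyEq h1).congr_fderiv ?_
    ext v
    have hcs : (ptApply I E E (nem A hA.continuous (γ 0))) (cst E v) = cst E (A x₀ v) := by
      ext t; simp [hγ0]
    have hio : ∀ w, intOp E (cst E w) 1 = w := by
      intro w
      rw [intOp_apply]
      have : extI (cst E w) = fun _ => w := rfl
      simp [this]
    simp only [add_apply, ContinuousLinearMap.comp_apply, evI_apply,
      map_zero, add_zero, ContinuousLinearEquiv.coe_coe,
      ContinuousLinearEquiv.refl_apply, hcs, hAx₀]
    simp [A₀, L, he, hio]
  obtain ⟨ee, hee, hs0, hsub, hsm, hsm'⟩ := inv_fun Γ 0 _ hmain hΓs _ hΓd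
  have htg : x₀ ∈ ee.target := by rw [← hΓ0, ← hee]; exact ee.map_source hs0
  have hg0 : ee.symm x₀ = 0 := by rw [← hΓ0, ← hee]; exact ee.left_inv hs0
  have htn : ∀ᶠ y in 𝓝 x₀, y ∈ ee.target := ee.open_target.mem_nhds htg
  refine ⟨fun y => η y (fderiv ℝ Γ (ee.symm y) e), fun y => η x₀ (ee.symm y), ?_, ?_, ?_, ?_, ?_⟩
  · filter_upwards [htn] with y hy
    have h1 := (hsm _ (ee.map_target hy)).fderiv_right (m := ∞) (by simp)
    exact hη.contDiffAt.clm_apply ((h1.comp y (hsm' y hy)).clm_apply contDiffAt_const)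
  · filter_upwards [htn] with y hy
    exact (η x₀).contDiff.contDiffAt.comp y (hsm' y hy)
  · simp only [hg0]
    rw [hΓd.fderiv]
    simpa using he
  · simp [hg0]
  · filter_upwards [htn] with y hy
    have hgd := ((hsm' y hy).differentiableAt (by simp)).hasFDerivAt
    have hxs := ee.map_target hy
    have hd : HasFDerivAt Γ (fderiv ℝ Γ (ee.symm y)) (ee.symm y) :=
      ((hsm _ hxs).differentiableAt (by simp)).hasFDerivAt
    have hq : fderiv ℝ (fun y => η x₀ (ee.symm y)) y = (η x₀).comp (fderiv ℝ ee.symm y) :=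
      ((η x₀).hasFDerivAt.comp y hgd).fderiv
    have hΓy : Γ (ee.symm y) = y := by rw [← hee]; exact ee.right_inv hy
    have hid : (fderiv ℝ Γ (ee.symm y)).comp (fderiv ℝ ee.symm y) = ContinuousLinearMap.id ℝ E := by
      refine (hd.comp y hgd).unique ((hasFDerivAt_id y).congr_of_eventuallyEq ?_)
      filter_upwards [ee.open_target.mem_nhds hy] with z hz
      simp only [Function.comp, id]
      rw [← hee]; exact ee.right_inv hz
    rw [hq]
    ext w
    have hw : w = fderiv ℝ Γ (ee.symm y) (fderiv ℝ ee.symm y w) :=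
      (congrArg (fun l => l w) hid).symm
    set v := fderiv ℝ ee.symm y w with hv
    have hz := hsub hxs (v - (η x₀ v) • e) (by simp [he])
    rw [hΓy, map_sub, map_sub, map_smul, map_smul, ← hw] at hz
    simp only [smul_apply, ContinuousLinearMap.comp_apply, smul_eq_mul] at hz ⊢
    rw [← hv]
    linarith
end Frob

end Part3

section Part4
open Real Filter
open scoped ContDiff Topology unitInterval

section PD

lemma pd_contDiff {f : Pt → ℝ} (hf : ContDiff ℝ ∞ f) (i : Fin 4) : ContDiff ℝ ∞ (pd i f) := by
  unfold pd
  exact (hf.fderiv_right (m := ∞) (by simp)).clm_apply contDiff_const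

lemma smooth_diff {f : Pt → ℝ} (hf : ContDiff ℝ ∞ f) : Differentiable ℝ f :=
  hf.differentiable (by simp)

lemma pd_comm {f : Pt → ℝ} (hf : ContDiff ℝ ∞ f) (i j : Fin 4) (x : Pt) :
    pd i (pd j f) x = pd j (pd i f) x := by
  have hd : DifferentiableAt ℝ (fderiv ℝ f) x :=
    (hf.fderiv_right (m := ∞) (by simp)).differentiable (by simp) x
  have h : ∀ k l, pd k (pd l f) x = fderiv ℝ (fderiv ℝ f) x (Pi.single k 1) (Pi.single l 1) := by
    intro k l
    have h1 := hd.hasFDerivAt.clm_apply (hasFDerivAt_const (Pi.single l (1:ℝ) : Pt) x)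
    have h2 : pd l f = fun y => fderiv ℝ f y (Pi.single l 1) := rfl
    rw [h2, pd, h1.fderiv]
    simp
  have hs : IsSymmSndFDerivAt ℝ f x := hf.contDiffAt.isSymmSndFDerivAt (by simp; exact WithTop.coe_le_coe.2 le_top)
  rw [h, h]
  exact hs _ _

lemma pd_add {f g : Pt → ℝ} {x : Pt} (i : Fin 4) (hf : DifferentiableAt ℝ f x)
    (hg : DifferentiableAt ℝ g x) : pd i (fun y => f y + g y) x = pd i f x + pd i g x := by
  simp only [pd]; rw [fderiv_fun_add hf hg]; rfl

lemma pd_sub {f g : Pt → ℝ} {x : Pt} (i : Fin 4) (hf : DifferentiableAt ℝ f x)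
    (hg : DifferentiableAt ℝ g x) : pd i (fun y => f y - g y) x = pd i f x - pd i g x := by
  simp only [pd]; rw [fderiv_fun_sub hf hg]; rfl

lemma pd_neg {f : Pt → ℝ} {x : Pt} (i : Fin 4) : pd i (fun y => - f y) x = - pd i f x := by
  simp only [pd]; rw [fderiv_fun_neg]; rfl

lemma pd_mul {f g : Pt → ℝ} {x : Pt} (i : Fin 4) (hf : DifferentiableAt ℝ f x)
    (hg : DifferentiableAt ℝ g x) :
    pd i (fun y => f y * g y) x = f x * pd i g x + pd i f x * g x := by
  simp only [pd]; rw [fderiv_fun_mul hf hg]; simp; ring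

lemma pd_congr {f g : Pt → ℝ} {x : Pt} (i : Fin 4) (h : f =ᶠ[𝓝 x] g) : pd i f x = pd i g x := by
  simp only [pd]; rw [h.fderiv_eq]

lemma pd_coord (i j : Fin 4) (x : Pt) : pd i (fun y => y j) x = if i = j then 1 else 0 := by
  have : HasFDerivAt (fun y : Pt => y j) (ContinuousLinearMap.proj j : Pt →L[ℝ] ℝ) x :=
    (ContinuousLinearMap.proj j : Pt →L[ℝ] ℝ).hasFDerivAt
  rw [pd, this.fderiv]
  simp [Pi.single_apply, eq_comm]

lemma pd_const (i : Fin 4) (c : ℝ) (x : Pt) : pd i (fun _ => c) x = 0 := by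
  simp [pd]

lemma update_eq (u : Pt) (i : Fin 4) (s : ℝ) :
    Function.update u i s = u + (s - u i) • (Pi.single i 1 : Pt) := by
  ext j
  by_cases h : j = i
  · subst h; simp
  · simp [h]

lemma pd_line {f : Pt → ℝ} (hf : Differentiable ℝ f) (u : Pt) (i : Fin 4) (s : ℝ) :
    HasDerivAt (fun s => f (Function.update u i s)) (pd i f (Function.update u i s)) s := by
  have h1 : HasDerivAt (fun s => Function.update u i s) (Pi.single i 1 : Pt) s := by
    simp only [update_eq]
    simpa using (((hasDerivAt_id s).sub_const (u i)).smul_const (Pi.single i 1 : Pt)).const_add u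
  exact (hf _).hasFDerivAt.comp_hasDerivAt s h1

lemma pd_eq_zero_of_indep {f : Pt → ℝ} (hf : Differentiable ℝ f) (i : Fin 4)
    (h : ∀ u s, f (Function.update u i s) = f u) (u : Pt) : pd i f u = 0 := by
  have h1 := pd_line hf u i (u i)
  simp only [h, Function.update_eq_self] at h1
  exact h1.unique (hasDerivAt_const _ _)

/-- Restriction to the coordinate hyperplane. -/
def rst (i : Fin 4) (f : Pt → ℝ) (u : Pt) : ℝ := f (Function.update u i 0)

lemma rst_contDiff {f : Pt → ℝ} (hf : ContDiff ℝ ∞ f) (i : Fin 4) : ContDiff ℝ ∞ (rst i f) := by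
  unfold rst
  simp only [update_eq]
  fun_prop

lemma rst_indep (f : Pt → ℝ) (i : Fin 4) (u : Pt) (s : ℝ) :
    rst i f (Function.update u i s) = rst i f u := by
  simp [rst]

/-- Partial antiderivative. -/
noncomputable def prim (i : Fin 4) (f : Pt → ℝ) (u : Pt) : ℝ :=
  ∫ s in (0:ℝ)..(u i), f (Function.update u i s)

lemma prim_indep {f : Pt → ℝ} {i j : Fin 4} (hij : i ≠ j)
    (h : ∀ u s, f (Function.update u j s) = f u) (u : Pt) (s : ℝ) :
    prim i f (Function.update u j s) = prim i f u := by
  unfold prim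
  rw [Function.update_of_ne hij]
  congr 1
  ext t
  rw [Function.update_comm hij.symm, h]

lemma cont_update {f : Pt → ℝ} (hf : Continuous f) (u : Pt) (i : Fin 4) :
    Continuous fun s => f (Function.update u i s) := by
  simp only [update_eq]
  fun_prop

/-- The path of the partial antiderivative. -/
noncomputable def primDir (i : Fin 4) : C(I, Pt) :=
  ⟨fun t => ((t : ℝ) - 1) • (Pi.single i 1 : Pt), by fun_prop⟩

/-- The path of the partial antiderivative. -/
noncomputable def primPath (i : Fin 4) (u : Pt) : C(I, Pt) := cst Pt u + u i • primDir i

lemma prim_eq {f : Pt → ℝ} (hf : Continuous f) (i : Fin 4) (u : Pt) :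
    prim i f u = u i * intOp ℝ (nem f hf (primPath i u)) 1 := by
  have h1 := intervalIntegral.smul_integral_comp_mul_right (a := 0) (b := 1)
    (fun s => f (Function.update u i s)) (u i)
  rw [zero_mul, one_mul] at h1
  rw [prim, ← h1, intOp_apply, smul_eq_mul]
  congr 1
  apply intervalIntegral.integral_congr
  intro t ht
  simp only [zero_le_one, Set.uIcc_of_le] at ht
  have : extI (nem f hf (primPath i u)) t = nem f hf (primPath i u) ⟨t, ht⟩ :=
    extI_of (nem f hf (primPath i u)) ⟨t, ht⟩
  simp only [this, nem_apply]
  congr 1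
  rw [update_eq]
  simp only [primPath, primDir, ContinuousMap.add_apply, cst_apply, ContinuousMap.smul_apply,
    ContinuousMap.coe_mk]
  rw [smul_smul]
  congr 2
  ring

lemma primPath_contDiff (i : Fin 4) : ContDiff ℝ ∞ (primPath i) := by
  unfold primPath
  fun_prop

lemma prim_contDiff {f : Pt → ℝ} (hf : ContDiff ℝ ∞ f) (i : Fin 4) : ContDiff ℝ ∞ (prim i f) := by
  have h : prim i f = fun u => u i * evI ℝ 1 (intOp ℝ (nem f hf.continuous (primPath i u))) := by
    ext u; rw [prim_eq hf.continuous]; rfl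
  rw [h]
  have h1 : ContDiff ℝ ∞ (nem f hf.continuous : C(I, Pt) → C(I, ℝ)) := nem_contDiff f hf
  have h2 := primPath_contDiff i
  fun_prop

lemma prim_pd_self {f : Pt → ℝ} (hf : ContDiff ℝ ∞ f) (i : Fin 4) (u : Pt) :
    pd i (prim i f) u = f u := by
  have h1 := pd_line (smooth_diff (prim_contDiff hf i)) u i (u i)
  simp only [prim, Function.update_self, Function.update_idem, Function.update_eq_self] at h1
  have hc := cont_update hf.continuous u i
  have h2 : HasDerivAt (fun t : ℝ => ∫ s in (0:ℝ)..t, f (Function.update u i s))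
      (f (Function.update u i (u i))) (u i) :=
    intervalIntegral.integral_hasDerivAt_right (hc.intervalIntegrable _ _)
      hc.stronglyMeasurable.stronglyMeasurableAtFilter hc.continuousAt
  rw [Function.update_eq_self] at h2
  exact h1.unique h2

lemma prim_pd_ne {f : Pt → ℝ} (hf : ContDiff ℝ ∞ f) {i j : Fin 4} (hij : i ≠ j) (u : Pt) :
    pd j (prim i f) u = prim i (pd j f) u := by
  have h : prim i f = fun u => u i * evI ℝ 1 (intOp ℝ (nem f hf.continuous (primPath i u))) := by
    ext u; rw [prim_eq hf.continuous]; rfl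
  have hp : HasFDerivAt (primPath i) (cst Pt + (ContinuousLinearMap.proj i : Pt →L[ℝ] ℝ).smulRight (primDir i)) u :=
    (cst Pt).hasFDerivAt.add ((ContinuousLinearMap.proj i : Pt →L[ℝ] ℝ).hasFDerivAt.smul_const (primDir i))
  have h1 := (nem_hasFDerivAt (X := I) f (hf.of_le (by simp)) (primPath i u)).comp u hp
  have h2 := (evI ℝ 1).hasFDerivAt.comp u ((intOp ℝ).hasFDerivAt.comp u h1)
  have h3 := ((ContinuousLinearMap.proj i : Pt →L[ℝ] ℝ).hasFDerivAt (x := u)).mul h2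
  have h4 := h3.congr_of_eventuallyEq (f₁ := prim i f) (Eventually.of_forall fun y => congrFun h y)
  rw [pd, h4.fderiv, prim_eq (pd_contDiff hf j).continuous]
  simp [hij]
  left
  congr 2

lemma prim_of_pd {f : Pt → ℝ} (hf : ContDiff ℝ ∞ f) (i : Fin 4) (u : Pt) :
    prim i (pd i f) u = f u - rst i f u := by
  unfold prim rst
  rw [intervalIntegral.integral_eq_sub_of_hasDerivAt (f := fun s => f (Function.update u i s))
    (fun s _ => pd_line (smooth_diff hf) u i s)
    ((cont_update (pd_contDiff hf i).continuous u i).intervalIntegrable _ _)]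
  simp

lemma update_mem {r : ℝ} {u : Pt} (hu : u ∈ Metric.ball (0 : Pt) r) (i : Fin 4) {s : ℝ}
    (hs : |s| ≤ |u i|) : Function.update u i s ∈ Metric.ball (0 : Pt) r := by
  rw [mem_ball_zero_iff] at *
  refine lt_of_le_of_lt ?_ hu
  rw [pi_norm_le_iff_of_nonneg (norm_nonneg _)]
  intro j
  by_cases h : j = i
  · subst h
    rw [Function.update_self]
    exact hs.trans (norm_le_pi_norm u j)
  · rw [Function.update_of_ne h]
    exact norm_le_pi_norm u j

lemma prim_congr {f g : Pt → ℝ} {r : ℝ} (h : ∀ u ∈ Metric.ball (0 : Pt) r, f u = g u) (i : Fin 4)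
    {u : Pt} (hu : u ∈ Metric.ball (0 : Pt) r) : prim i f u = prim i g u := by
  unfold prim
  apply intervalIntegral.integral_congr
  intro s hs
  apply h
  apply update_mem hu
  have := Set.abs_sub_left_of_mem_uIcc hs
  simpa using this

lemma rst_of_pd_zero {f : Pt → ℝ} (hf : ContDiff ℝ ∞ f) {r : ℝ} (i : Fin 4)
    (h : ∀ u ∈ Metric.ball (0 : Pt) r, pd i f u = 0)
    {u : Pt} (hu : u ∈ Metric.ball (0 : Pt) r) : rst i f u = f u := by
  have h1 := prim_of_pd hf i u
  have h2 := prim_congr (g := fun _ => 0) h i hu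
  rw [h1] at h2
  simp [prim] at h2
  linarith

lemma pd_congr_ball {f g : Pt → ℝ} {r : ℝ} (h : ∀ u ∈ Metric.ball (0 : Pt) r, f u = g u) (i : Fin 4)
    {u : Pt} (hu : u ∈ Metric.ball (0 : Pt) r) : pd i f u = pd i g u :=
  pd_congr i (by filter_upwards [Metric.isOpen_ball.mem_nhds hu] with y hy using h y hy)

/-- Relative Poincare lemma in the variables 1 and 3. -/
lemma rel_poincare {a b : Pt → ℝ} (ha : ContDiff ℝ ∞ a) (hb : ContDiff ℝ ∞ b) {r : ℝ}
    (h : ∀ u ∈ Metric.ball (0 : Pt) r, pd 3 a u = pd 1 b u) :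
    ∃ F : Pt → ℝ, ContDiff ℝ ∞ F ∧ F 0 = 0 ∧
      ∀ u ∈ Metric.ball (0 : Pt) r, pd 1 F u = a u ∧ pd 3 F u = b u := by
  have h1 := prim_contDiff ha 1
  have h2 := prim_contDiff (rst_contDiff hb 1) 3
  refine ⟨fun u => prim 1 a u + prim 3 (rst 1 b) u, h1.add h2, by simp [prim], ?_⟩
  intro u hu
  rw [pd_add _ (smooth_diff h1 u) (smooth_diff h2 u), pd_add _ (smooth_diff h1 u) (smooth_diff h2 u)]
  rw [prim_pd_self ha, prim_pd_self (rst_contDiff hb 1), prim_pd_ne ha (by decide),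
    prim_congr h 1 hu, prim_of_pd hb,
    pd_eq_zero_of_indep (smooth_diff h2) 1 (prim_indep (by decide) (rst_indep b 1))]
  constructor <;> ring

end PD

end Part4

section Part5
open Real Filter
open scoped ContDiff Topology

section NF

lemma adapted_normal_form (c01 c02 c03 c12 c13 c23 : Pt → ℝ)
    (h01 : ContDiff ℝ ∞ c01) (h02 : ContDiff ℝ ∞ c02) (h03 : ContDiff ℝ ∞ c03)
    (h12 : ContDiff ℝ ∞ c12) (h13 : ContDiff ℝ ∞ c13) (h23 : ContDiff ℝ ∞ c23) (r : ℝ)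
    (E012 : ∀ u ∈ Metric.ball (0 : Pt) r, pd 0 c12 u - pd 1 c02 u + pd 2 c01 u = (1 + u 0) * c01 u)
    (E013 : ∀ u ∈ Metric.ball (0 : Pt) r, pd 0 c13 u - pd 1 c03 u + pd 3 c01 u = 0)
    (E023 : ∀ u ∈ Metric.ball (0 : Pt) r, pd 0 c23 u - pd 2 c03 u + pd 3 c02 u = - ((1 + u 0) * c03 u))
    (E123 : ∀ u ∈ Metric.ball (0 : Pt) r, pd 1 c23 u - pd 2 c13 u + pd 3 c12 u = - ((1 + u 0) * c13 u)) :
    ∃ X Y : Pt → ℝ, ContDiff ℝ ∞ X ∧ ContDiff ℝ ∞ Y ∧ X 0 = 0 ∧ Y 0 = 0 ∧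
      ∀ u ∈ Metric.ball (0 : Pt) r,
        c01 u = rexp ((1 + u 0) * u 2) * pd 1 X u ∧
        c02 u = rexp ((1 + u 0) * u 2) * pd 2 X u - pd 0 Y u ∧
        c03 u = rexp ((1 + u 0) * u 2) * pd 3 X u ∧
        c12 u = - pd 1 Y u ∧ c13 u = 0 ∧ c23 u = pd 3 Y u := by
  have D : ∀ {f : Pt → ℝ}, ContDiff ℝ ∞ f → ∀ x, DifferentiableAt ℝ f x := fun hf => smooth_diff hf
  have S : ∀ {f : Pt → ℝ}, ContDiff ℝ ∞ f → ∀ i, ContDiff ℝ ∞ (pd i f) := fun hf => pd_contDiff hf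
  have hP : ContDiff ℝ ∞ (fun u : Pt => 1 + u 0) := by fun_prop
  have dP : ∀ i x, pd i (fun u : Pt => 1 + u 0) x = if i = 0 then 1 else 0 := by
    intro i x
    rw [pd_add i (by fun_prop) (by fun_prop), pd_const, pd_coord, zero_add]
  have d3 : ∀ {f g h : Pt → ℝ}, ContDiff ℝ ∞ f → ContDiff ℝ ∞ g → ContDiff ℝ ∞ h → ∀ i x,
      pd i (fun u => f u - g u + h u) x = pd i f x - pd i g x + pd i h x := by
    intro f g h hf hg hh i x
    rw [pd_add (f := fun u => f u - g u) i ((D hf x).sub (D hg x)) (D hh x), pd_sub i (D hf x) (D hg x)]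
  -- c13 = 0
  have hz : ∀ u ∈ Metric.ball (0 : Pt) r, c13 u = 0 := by
    intro u hu
    have a1 := pd_congr_ball E012 3 hu
    have a2 := pd_congr_ball E013 2 hu
    have a3 := pd_congr_ball E023 1 hu
    have a4 := pd_congr_ball E123 0 hu
    rw [d3 (S h12 0) (S h02 1) (S h01 2), pd_mul _ (D hP u) (D h01 u), dP] at a1
    rw [d3 (S h13 0) (S h03 1) (S h01 3), pd_const] at a2
    rw [d3 (S h23 0) (S h03 2) (S h02 3), pd_neg, pd_mul _ (D hP u) (D h03 u), dP] at a3
    rw [d3 (S h23 1) (S h13 2) (S h12 3), pd_neg, pd_mul _ (D hP u) (D h13 u), dP] at a4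
    simp only [Fin.reduceEq, if_true, if_false, zero_mul, one_mul, add_zero] at a1 a2 a3 a4
    have e := E013 u hu
    have s1 := pd_comm h12 3 0 u
    have s2 := pd_comm h02 3 1 u
    have s3 := pd_comm h01 3 2 u
    have s4 := pd_comm h13 2 0 u
    have s5 := pd_comm h03 2 1 u
    have s6 := pd_comm h23 1 0 u
    linear_combination -(a1 - a2 + a3 - a4 - s1 + s2 - s3 + s4 - s5 - s6) - (1 + u 0) * e
  have hz' : ∀ i, ∀ u ∈ Metric.ball (0 : Pt) r, pd i c13 u = 0 := by
    intro i u hu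
    rw [pd_congr_ball (g := fun _ => 0) hz i hu, pd_const]
  obtain ⟨F, hF, hF0, hFd⟩ := rel_poincare h01 h03 (r := r) (by
    intro u hu
    have := E013 u hu
    rw [hz' 0 u hu] at this
    linarith)
  obtain ⟨G, hG, hG0, hGd⟩ := rel_poincare h12.neg h23 (r := r) (by
    intro u hu
    have := E123 u hu
    rw [hz' 2 u hu, hz u hu] at this
    have h2 : pd 3 (fun x => - c12 x) u = - pd 3 c12 u := pd_neg 3
    rw [h2]
    linarith)
  -- the remaining function
  let h : Pt → ℝ := fun u => c02 u - pd 2 F u + pd 0 G u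
  have hh : ContDiff ℝ ∞ h := (h02.sub (S hF 2)).add (S hG 0)
  let m : Pt → ℝ := fun u => h u + (1 + u 0) * F u
  have hPF : ContDiff ℝ ∞ (fun u : Pt => (1 + u 0) * F u) := hP.mul hF
  have hm : ContDiff ℝ ∞ m := hh.add hPF
  have dm : ∀ i ≠ 0, ∀ u, pd i m u = pd i c02 u - pd 2 (pd i F) u + pd 0 (pd i G) u + (1 + u 0) * pd i F u := by
    intro i hi u
    rw [pd_add i (D hh u) (D hPF u), pd_mul i (D hP u) (D hF u), dP, if_neg hi,
      d3 h02 (S hF 2) (S hG 0), pd_comm hF, pd_comm hG]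
    ring
  have m1 : ∀ u ∈ Metric.ball (0 : Pt) r, pd 1 m u = 0 := by
    intro u hu
    rw [dm 1 (by decide) u, pd_congr_ball (fun y hy => (hFd y hy).1) 2 hu,
      pd_congr_ball (fun y hy => (hGd y hy).1) 0 hu, (hFd u hu).1]
    have h2 : pd 0 (fun x => - c12 x) u = - pd 0 c12 u := pd_neg 0
    rw [h2]
    linarith [E012 u hu]
  have m3 : ∀ u ∈ Metric.ball (0 : Pt) r, pd 3 m u = 0 := by
    intro u hu
    rw [dm 3 (by decide) u, pd_congr_ball (fun y hy => (hFd y hy).2) 2 hu,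
      pd_congr_ball (fun y hy => (hGd y hy).2) 0 hu, (hFd u hu).2]
    linarith [E023 u hu]
  let k : Pt → ℝ := rst 1 (rst 3 m)
  have hk : ContDiff ℝ ∞ k := rst_contDiff (rst_contDiff hm 3) 1
  have hkm : ∀ u ∈ Metric.ball (0 : Pt) r, k u = m u := by
    intro u hu
    have hu' : Function.update u 1 0 ∈ Metric.ball (0 : Pt) r := update_mem hu 1 (by simp)
    have e1 : k u = rst 3 m (Function.update u 1 0) := rfl
    rw [e1, rst_of_pd_zero hm 3 m3 hu']
    exact rst_of_pd_zero hm 1 m1 hu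
  have k1 : ∀ u s, k (Function.update u 1 s) = k u := rst_indep _ 1
  have k3 : ∀ u s, k (Function.update u 3 s) = k u := by
    intro u s
    simp only [k, rst]
    congr 1
    ext j
    fin_cases j <;> simp
  let K : Pt → ℝ := prim 0 k
  have hK : ContDiff ℝ ∞ K := prim_contDiff hk 0
  have K0 : ∀ u, pd 0 K u = k u := prim_pd_self hk 0
  have K1 : ∀ u, pd 1 K u = 0 := pd_eq_zero_of_indep (smooth_diff hK) 1 (prim_indep (by decide) k1)
  have K3 : ∀ u, pd 3 K u = 0 := pd_eq_zero_of_indep (smooth_diff hK) 3 (prim_indep (by decide) k3)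
  let ex : Pt → ℝ := fun u => rexp (-((1 + u 0) * u 2))
  have hex : ContDiff ℝ ∞ ex := by fun_prop
  have dex : ∀ i u, pd i ex u = - ex u * ((1 + u 0) * (if i = 2 then 1 else 0) + (if i = 0 then 1 else 0) * u 2) := by
    intro i u
    have hin : ContDiff ℝ ∞ (fun u : Pt => -((1 + u 0) * u 2)) := by fun_prop
    have hc2 : ContDiff ℝ ∞ (fun u : Pt => u 2) := by fun_prop
    have e1 : pd i ex u = ex u * pd i (fun u : Pt => -((1 + u 0) * u 2)) u := by
      have := (D hin u).hasFDerivAt.exp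
      rw [pd, this.fderiv]; rfl
    rw [e1, pd_neg, pd_mul i (D hP u) (D hc2 u), dP, pd_coord]
    ring
  refine ⟨fun u => ex u * F u, fun u => G u - K u, hex.mul hF, hG.sub hK, by simp [hF0], by simp [hG0, K, prim], ?_⟩
  intro u hu
  have hee : rexp ((1 + u 0) * u 2) * ex u = 1 := by
    simp only [ex]; rw [← Real.exp_add]; simp
  have hX : ∀ i, pd i (fun u => ex u * F u) u = ex u * pd i F u + pd i ex u * F u :=
    fun i => pd_mul i (D hex u) (D hF u)
  have hY : ∀ i, pd i (fun u => G u - K u) u = pd i G u - pd i K u :=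
    fun i => pd_sub i (D hG u) (D hK u)
  simp only [hX, hY, dex, K0, K1, K3, (hFd u hu).1, (hFd u hu).2, (hGd u hu).1, (hGd u hu).2, hz u hu, hkm u hu]
  simp only [Fin.reduceEq, if_true, if_false]
  refine ⟨?_, ?_, ?_, ?_, ?_, ?_⟩
  · linear_combination (- c01 u) * hee
  · simp only [m, h]
    linear_combination (- pd 2 F u + (1 + u 0) * F u) * hee
  · linear_combination (- c03 u) * hee
  · ring
  · trivial
  · ring

end NF

end Part5

section Part6
open Real Filter
open scoped ContDiff Topology

section Lin

/-- Bilinear form with given components. -/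
noncomputable def b2 (M : Fin 4 → Fin 4 → ℝ) : Pt →L[ℝ] Pt →L[ℝ] ℝ :=
  ∑ i, ∑ j, M i j • (ContinuousLinearMap.proj i : Pt →L[ℝ] ℝ).smulRight
    (ContinuousLinearMap.proj j : Pt →L[ℝ] ℝ)

/-- Linear form with given components. -/
noncomputable def b1 (c : Fin 4 → ℝ) : Pt →L[ℝ] ℝ :=
  ∑ i, c i • (ContinuousLinearMap.proj i : Pt →L[ℝ] ℝ)

lemma b2_apply (M : Fin 4 → Fin 4 → ℝ) (v w : Pt) :
    b2 M v w = ∑ i, ∑ j, M i j * (v i * w j) := by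
  simp [b2]

lemma b1_apply (c : Fin 4 → ℝ) (v : Pt) : b1 c v = ∑ i, c i * v i := by
  simp [b1]

lemma b2_contDiff : ContDiff ℝ ∞ b2 := by
  rw [contDiff_clm_apply_iff]
  intro v
  rw [contDiff_clm_apply_iff]
  intro w
  simp only [b2_apply]
  refine ContDiff.sum fun i _ => ContDiff.sum fun j _ => ContDiff.mul ?_ contDiff_const
  exact contDiff_apply_apply ℝ ℝ i j

lemma b1_contDiff : ContDiff ℝ ∞ b1 := by
  unfold b1; fun_prop

lemma covec_apply (c : Fin 4 → ℝ) (v : Pt) : covec c v = ∑ i, c i * v i := by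
  simp [covec]

lemma fderiv_eq_sum (f : Pt → ℝ) (x v : Pt) : fderiv ℝ f x v = ∑ i, v i * pd i f x := by
  conv_lhs => rw [pi_eq_sum_univ' v, map_sum]
  simp [pd]

lemma fderiv_b1 {w : Pt → Fin 4 → ℝ} {x : Pt} (hw : DifferentiableAt ℝ w x) (X Y : Pt) :
    fderiv ℝ (fun y => b1 (w y)) x X Y = ∑ i, ∑ j, X i * Y j * pd i (fun y => w y j) x := by
  have hd : DifferentiableAt ℝ (fun y => b1 (w y)) x :=
    (b1_contDiff.differentiable (by simp) _).comp x hw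
  have h1 := (hd.hasFDerivAt.clm_apply (hasFDerivAt_const Y x)).fderiv
  have h2 : fderiv ℝ (fun y => b1 (w y)) x X Y = fderiv ℝ (fun y => b1 (w y) Y) x X := by
    rw [h1]; simp
  have hj : ∀ j, DifferentiableAt ℝ (fun y => w y j) x := fun j => differentiableAt_pi.1 hw j
  have h3 : HasFDerivAt (fun y => ∑ j, w y j * Y j) (∑ j, Y j • fderiv ℝ (fun y => w y j) x) x :=
    HasFDerivAt.fun_sum fun j _ => (hj j).hasFDerivAt.mul_const (Y j)
  rw [h2]
  simp only [b1_apply]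
  rw [h3.fderiv]
  simp only [sum_apply, smul_apply, fderiv_eq_sum, smul_eq_mul, Finset.mul_sum]
  rw [Finset.sum_comm]
  refine Finset.sum_congr rfl fun i _ => Finset.sum_congr rfl fun j _ => ?_
  ring

lemma fderiv_b2 {w : Pt → Fin 4 → Fin 4 → ℝ} {x : Pt} (hw : DifferentiableAt ℝ w x) (X Y Z : Pt) :
    fderiv ℝ (fun y => b2 (w y)) x X Y Z =
      ∑ i, ∑ j, ∑ k, X i * Y j * Z k * pd i (fun y => w y j k) x := by
  have hd : DifferentiableAt ℝ (fun y => b2 (w y)) x :=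
    (b2_contDiff.differentiable (by simp) _).comp x hw
  have h1 := ((hd.hasFDerivAt.clm_apply (hasFDerivAt_const Y x)).clm_apply (hasFDerivAt_const Z x)).fderiv
  have h2 : fderiv ℝ (fun y => b2 (w y)) x X Y Z = fderiv ℝ (fun y => b2 (w y) Y Z) x X := by
    rw [h1]; simp
  have hj : ∀ j k, DifferentiableAt ℝ (fun y => w y j k) x :=
    fun j k => differentiableAt_pi.1 (differentiableAt_pi.1 hw j) k
  have h3 : HasFDerivAt (fun y => ∑ j, ∑ k, w y j k * (Y j * Z k))
      (∑ j, ∑ k, (Y j * Z k) • fderiv ℝ (fun y => w y j k) x) x :=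
    HasFDerivAt.fun_sum fun j _ => HasFDerivAt.fun_sum fun k _ => (hj j k).hasFDerivAt.mul_const _
  rw [h2]
  simp only [b2_apply]
  rw [h3.fderiv]
  simp only [sum_apply, smul_apply, fderiv_eq_sum, smul_eq_mul, Finset.mul_sum]
  have : ∀ j : Fin 4, (∑ k : Fin 4, ∑ i : Fin 4, Y j * Z k * (X i * pd i (fun y => w y j k) x))
      = ∑ i : Fin 4, ∑ k : Fin 4, Y j * Z k * (X i * pd i (fun y => w y j k) x) :=
    fun j => Finset.sum_comm
  simp only [this]
  rw [Finset.sum_comm]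
  refine Finset.sum_congr rfl fun i _ => Finset.sum_congr rfl fun j _ =>
    Finset.sum_congr rfl fun k _ => ?_
  ring

/-- Exterior derivative of a 2-form, invariantly. -/
noncomputable def D3 (B : Pt → Pt →L[ℝ] Pt →L[ℝ] ℝ) (x X Y Z : Pt) : ℝ :=
  fderiv ℝ B x X Y Z - fderiv ℝ B x Y X Z + fderiv ℝ B x Z X Y

lemma D3_eq {Ω : Form2} {x : Pt} (hΩ : DifferentiableAt ℝ Ω x) (X Y Z : Pt) :
    D3 (fun y => b2 (Ω y)) x X Y Z = ∑ i, ∑ j, ∑ k, X i * Y j * Z k * d2 Ω x i j k := by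
  unfold D3
  rw [fderiv_b2 hΩ, fderiv_b2 hΩ, fderiv_b2 hΩ]
  have e2 : (∑ i, ∑ j, ∑ k, Y i * X j * Z k * pd i (fun y => Ω y j k) x)
      = ∑ i, ∑ j, ∑ k, X i * Y j * Z k * pd j (fun y => Ω y i k) x := by
    rw [Finset.sum_comm]
    refine Finset.sum_congr rfl fun i _ => Finset.sum_congr rfl fun j _ =>
      Finset.sum_congr rfl fun k _ => ?_
    ring
  have e3 : (∑ i, ∑ j, ∑ k, Z i * X j * Y k * pd i (fun y => Ω y j k) x)
      = ∑ i, ∑ j, ∑ k, X i * Y j * Z k * pd k (fun y => Ω y i j) x := by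
    rw [Finset.sum_comm]
    refine Finset.sum_congr rfl fun i _ => ?_
    rw [Finset.sum_comm]
    refine Finset.sum_congr rfl fun j _ => Finset.sum_congr rfl fun k _ => ?_
    ring
  rw [e2, e3]
  simp only [← Finset.sum_sub_distrib, ← Finset.sum_add_distrib]
  refine Finset.sum_congr rfl fun i _ => Finset.sum_congr rfl fun j _ =>
    Finset.sum_congr rfl fun k _ => ?_
  unfold d2
  ring

lemma w12_eq (w : Form1) (Ω : Form2) (x X Y Z : Pt) :
    (∑ i, ∑ j, ∑ k, X i * Y j * Z k * w12 w Ω x i j k) =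
      b1 (w x) X * b2 (Ω x) Y Z - b1 (w x) Y * b2 (Ω x) X Z + b1 (w x) Z * b2 (Ω x) X Y := by
  have e1 : b1 (w x) X * b2 (Ω x) Y Z = ∑ i, ∑ j, ∑ k, X i * Y j * Z k * (w x i * Ω x j k) := by
    rw [b1_apply, b2_apply]
    rw [Finset.sum_mul]; simp only [Finset.mul_sum]
    refine Finset.sum_congr rfl fun i _ => Finset.sum_congr rfl fun j _ =>
      Finset.sum_congr rfl fun k _ => ?_
    ring
  have e2 : b1 (w x) Y * b2 (Ω x) X Z = ∑ i, ∑ j, ∑ k, X i * Y j * Z k * (w x j * Ω x i k) := by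
    rw [b1_apply, b2_apply]
    rw [Finset.sum_mul]; simp only [Finset.mul_sum]
    rw [Finset.sum_comm]
    refine Finset.sum_congr rfl fun i _ => Finset.sum_congr rfl fun j _ =>
      Finset.sum_congr rfl fun k _ => ?_
    ring
  have e3 : b1 (w x) Z * b2 (Ω x) X Y = ∑ i, ∑ j, ∑ k, X i * Y j * Z k * (w x k * Ω x i j) := by
    rw [b1_apply, b2_apply]
    rw [Finset.sum_mul]; simp only [Finset.mul_sum]
    rw [Finset.sum_comm]
    refine Finset.sum_congr rfl fun i _ => ?_
    rw [Finset.sum_comm]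
    refine Finset.sum_congr rfl fun j _ => Finset.sum_congr rfl fun k _ => ?_
    ring
  rw [e1, e2, e3]
  simp only [← Finset.sum_sub_distrib, ← Finset.sum_add_distrib]
  refine Finset.sum_congr rfl fun i _ => Finset.sum_congr rfl fun j _ =>
    Finset.sum_congr rfl fun k _ => ?_
  unfold w12
  ring

lemma dform_b1 {w : Form1} {x : Pt} (hw : DifferentiableAt ℝ w x) (X Y : Pt) :
    dform (fun y => b1 (w y)) x X Y = ∑ i, ∑ j, X i * Y j * d1 w x i j := by
  unfold dform
  rw [fderiv_b1 hw, fderiv_b1 hw]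
  have e2 : (∑ i, ∑ j, Y i * X j * pd i (fun y => w y j) x)
      = ∑ i, ∑ j, X i * Y j * pd j (fun y => w y i) x := by
    rw [Finset.sum_comm]
    refine Finset.sum_congr rfl fun i _ => Finset.sum_congr rfl fun j _ => ?_
    ring
  rw [e2]
  simp only [← Finset.sum_sub_distrib]
  refine Finset.sum_congr rfl fun i _ => Finset.sum_congr rfl fun j _ => ?_
  unfold d1
  ring

/-- Naturality of the exterior derivative. -/
lemma pullback_D3 (B : Pt → Pt →L[ℝ] Pt →L[ℝ] ℝ) (φ : Pt → Pt) (u : Pt)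
    (hφ : ContDiffAt ℝ ∞ φ u) (hB : DifferentiableAt ℝ B (φ u))
    (halt : ∀ v w, B (φ u) v w = - B (φ u) w v) (X Y Z : Pt) :
    fderiv ℝ (fun y => B (φ y) (fderiv ℝ φ y Y) (fderiv ℝ φ y Z)) u X
      - fderiv ℝ (fun y => B (φ y) (fderiv ℝ φ y X) (fderiv ℝ φ y Z)) u Y
      + fderiv ℝ (fun y => B (φ y) (fderiv ℝ φ y X) (fderiv ℝ φ y Y)) u Z
      = D3 B (φ u) (fderiv ℝ φ u X) (fderiv ℝ φ u Y) (fderiv ℝ φ u Z) := by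
  have hd : HasFDerivAt (fderiv ℝ φ) (fderiv ℝ (fderiv ℝ φ) u) u :=
    ((hφ.fderiv_right (m := ∞) (by simp)).differentiableAt (by simp)).hasFDerivAt
  have hφd : HasFDerivAt φ (fderiv ℝ φ u) u := (hφ.differentiableAt (by simp)).hasFDerivAt
  have hBφ : HasFDerivAt (fun y => B (φ y)) ((fderiv ℝ B (φ u)).comp (fderiv ℝ φ u)) u :=
    HasFDerivAt.comp (g := B) u hB.hasFDerivAt hφd
  have hs : IsSymmSndFDerivAt ℝ φ u :=
    hφ.isSymmSndFDerivAt (by simp; exact WithTop.coe_le_coe.2 le_top)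
  have key : ∀ P Q R, fderiv ℝ (fun y => B (φ y) (fderiv ℝ φ y P) (fderiv ℝ φ y Q)) u R =
      fderiv ℝ B (φ u) (fderiv ℝ φ u R) (fderiv ℝ φ u P) (fderiv ℝ φ u Q)
      + B (φ u) (fderiv ℝ (fderiv ℝ φ) u R P) (fderiv ℝ φ u Q)
      + B (φ u) (fderiv ℝ φ u P) (fderiv ℝ (fderiv ℝ φ) u R Q) := by
    intro P Q R
    have h := ((hBφ.clm_apply (hd.clm_apply (hasFDerivAt_const P u))).clm_apply
      (hd.clm_apply (hasFDerivAt_const Q u))).fderiv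
    rw [h]
    simp
    ring
  rw [key, key, key, D3, hs Y X, hs Z X, hs Z Y, halt (fderiv ℝ φ u X) (fderiv ℝ (fderiv ℝ φ) u Y Z)]
  rw [halt (fderiv ℝ φ u Y) (fderiv ℝ (fderiv ℝ φ) u X Z)]
  ring

end Lin

end Part6

section Part7
open Real Filter
open scoped ContDiff Topology

section ClassTwo

lemma mem_K {w : Form1} {x : Pt} (hw : DifferentiableAt ℝ w x) (v : Pt) :
    v ∈ (LinearMap.ker (covec (w x)) ⊓ ⨅ j, LinearMap.ker (covec (fun i => d1 w x i j)))
      ↔ b1 (w x) v = 0 ∧ ∀ Y, dform (fun y => b1 (w y)) x v Y = 0 := by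
  rw [Submodule.mem_inf, Submodule.mem_iInf]
  simp only [LinearMap.mem_ker, covec_apply, b1_apply, dform_b1 hw]
  refine and_congr Iff.rfl ⟨fun h Y => ?_, fun h j => ?_⟩
  · rw [Finset.sum_comm]
    refine Finset.sum_eq_zero fun j _ => ?_
    calc (∑ i, v i * Y j * d1 w x i j) = Y j * ∑ i, d1 w x i j * v i := by
          rw [Finset.mul_sum]; exact Finset.sum_congr rfl fun i _ => by ring
      _ = 0 := by rw [h j, mul_zero]
  · have := h (Pi.single j 1)
    rw [Finset.sum_comm, Finset.sum_eq_single j] at this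
    · rw [← this]
      exact Finset.sum_congr rfl fun i _ => by simp; ring
    · intro b _ hb
      refine Finset.sum_eq_zero fun i _ => ?_
      simp [Pi.single_eq_of_ne hb]
    · simp

lemma dform_antisymm (η : Pt → Pt →L[ℝ] ℝ) (x X Y : Pt) :
    dform η x X Y = - dform η x Y X := by
  unfold dform; ring

lemma finrank_K {w : Form1} {x : Pt} (hc : classAt w x = 2) : Module.finrank ℝ
    ↥(LinearMap.ker (covec (w x)) ⊓ ⨅ j, LinearMap.ker (covec (fun i => d1 w x i j))) = 2 := by
  unfold classAt at hc
  omega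

lemma integ_of_class {w : Form1} {x : Pt} (hw : DifferentiableAt ℝ w x) (hc : classAt w x = 2) :
    Integ (fun y => b1 (w y)) x := by
  intro X Y Z
  have hK := finrank_K hc
  set K := (LinearMap.ker (covec (w x)) ⊓ ⨅ j, LinearMap.ker (covec (fun i => d1 w x i j))) with hKd
  have hq : Module.finrank ℝ (Pt ⧸ K) = 2 := by
    have := Submodule.finrank_quotient_add_finrank K
    have h4 : Module.finrank ℝ Pt = 4 := by simp
    omega
  have hnot : ¬ LinearIndependent ℝ (fun i : Fin 3 => K.mkQ ((![X, Y, Z] : Fin 3 → Pt) i)) := by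
    intro h
    have := h.fintype_card_le_finrank
    rw [hq] at this
    simp at this
  rw [Fintype.not_linearIndependent_iff] at hnot
  obtain ⟨g, hg, hne⟩ := hnot
  have hg' : g 0 • X + g 1 • Y + g 2 • Z ∈ K := by
    rw [← K.ker_mkQ, LinearMap.mem_ker]
    simpa [Fin.sum_univ_three] using hg
  rw [hKd, mem_K hw] at hg'
  obtain ⟨h0, h1⟩ := hg'
  have hlin : ∀ V, dform (fun y => b1 (w y)) x (g 0 • X + g 1 • Y + g 2 • Z) V =
      g 0 * dform (fun y => b1 (w y)) x X V + g 1 * dform (fun y => b1 (w y)) x Y V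
      + g 2 * dform (fun y => b1 (w y)) x Z V := by
    intro V
    unfold dform
    simp
    ring
  have hX := h1 X
  have hY := h1 Y
  have hZ := h1 Z
  rw [hlin] at hX hY hZ
  have sXX := dform_antisymm (fun y => b1 (w y)) x X X
  have sYY := dform_antisymm (fun y => b1 (w y)) x Y Y
  have sZZ := dform_antisymm (fun y => b1 (w y)) x Z Z
  rw [dform_antisymm _ x Y X] at hX
  rw [dform_antisymm _ x Z Y] at hY
  rw [dform_antisymm _ x X Z] at hZ
  simp only [map_add, map_smul, smul_eq_mul] at h0
  generalize dform (fun y => b1 (w y)) x X X = xx at *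
  generalize dform (fun y => b1 (w y)) x Y Y = yy at *
  generalize dform (fun y => b1 (w y)) x Z Z = zz at *
  generalize dform (fun y => b1 (w y)) x X Y = d12 at *
  generalize dform (fun y => b1 (w y)) x Y Z = d23 at *
  generalize dform (fun y => b1 (w y)) x Z X = d31 at *
  have ex : xx = 0 := by linarith
  have ey : yy = 0 := by linarith
  have ez : zz = 0 := by linarith
  subst ex ey ez
  change d12 * b1 (w x) Z + d23 * b1 (w x) X + d31 * b1 (w x) Y = 0
  generalize b1 (w x) X = a at *
  generalize b1 (w x) Y = b at *
  generalize b1 (w x) Z = c at *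
  obtain ⟨i, hi⟩ := hne
  refine (mul_eq_zero.1 (?_ : g i * (d12 * c + d23 * a + d31 * b) = 0)).resolve_left hi
  fin_cases i
  · simp only [Fin.zero_eta]
    linear_combination d23 * h0 + c * hY - b * hZ
  · simp only [Fin.mk_one]
    linear_combination d31 * h0 - c * hX + a * hZ
  · simp only [Fin.reduceFinMk]
    linear_combination d12 * h0 + b * hX - a * hY

lemma dform_ne_of_class {w : Form1} {x : Pt} (hw : DifferentiableAt ℝ w x)
    (hc : classAt w x = 2) : ∃ X Y, dform (fun y => b1 (w y)) x X Y ≠ 0 := by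
  by_contra! hcon
  have hK := finrank_K hc
  have hle : LinearMap.ker (covec (w x)) ≤
      (LinearMap.ker (covec (w x)) ⊓ ⨅ j, LinearMap.ker (covec (fun i => d1 w x i j))) := by
    intro v hv
    rw [mem_K hw]
    refine ⟨?_, fun Y => hcon v Y⟩
    rw [LinearMap.mem_ker, covec_apply] at hv
    rw [b1_apply, hv]
  have h1 := Submodule.finrank_mono hle
  have h2 := LinearMap.finrank_range_add_finrank_ker (covec (w x))
  have h3 : Module.finrank ℝ (LinearMap.range (covec (w x))) ≤ Module.finrank ℝ ℝ :=
    Submodule.finrank_le _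
  have h4 : Module.finrank ℝ Pt = 4 := by simp
  have h5 : Module.finrank ℝ ℝ = 1 := by simp
  omega

end ClassTwo

end Part7

section Part8
open Real Filter
open scoped ContDiff Topology

section ChartOne

lemma dform_pdq {η : Pt → Pt →L[ℝ] ℝ} {p q : Pt → ℝ} {x₀ : Pt}
    (hp : ContDiffAt ℝ ∞ p x₀) (hq : ContDiffAt ℝ ∞ q x₀)
    (h : ∀ᶠ x in 𝓝 x₀, η x = p x • fderiv ℝ q x) (X Y : Pt) :
    dform η x₀ X Y = fderiv ℝ p x₀ X * fderiv ℝ q x₀ Y - fderiv ℝ p x₀ Y * fderiv ℝ q x₀ X := by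
  have hd : HasFDerivAt (fderiv ℝ q) (fderiv ℝ (fderiv ℝ q) x₀) x₀ :=
    ((hq.fderiv_right (m := ∞) (by simp)).differentiableAt (by simp)).hasFDerivAt
  have hpd : HasFDerivAt p (fderiv ℝ p x₀) x₀ := (hp.differentiableAt (by simp)).hasFDerivAt
  have hs : IsSymmSndFDerivAt ℝ q x₀ :=
    hq.isSymmSndFDerivAt (by simp; exact WithTop.coe_le_coe.2 le_top)
  have e1 : fderiv ℝ η x₀ = fderiv ℝ (fun x => p x • fderiv ℝ q x) x₀ :=
    Filter.EventuallyEq.fderiv_eq h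
  unfold dform
  rw [e1, (hpd.fun_smul hd).fderiv]
  simp [hs X Y]

lemma exists_minor {p q : Pt → ℝ} {x₀ X Y : Pt}
    (h : fderiv ℝ p x₀ X * fderiv ℝ q x₀ Y - fderiv ℝ p x₀ Y * fderiv ℝ q x₀ X ≠ 0) :
    ∃ i j, pd i p x₀ * pd j q x₀ - pd j p x₀ * pd i q x₀ ≠ 0 := by
  by_contra! hc
  apply h
  simp only [fderiv_eq_sum, Fin.sum_univ_four]
  linear_combination (X 0 * Y 1 - X 1 * Y 0) * hc 0 1 + (X 0 * Y 2 - X 2 * Y 0) * hc 0 2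
    + (X 0 * Y 3 - X 3 * Y 0) * hc 0 3 + (X 1 * Y 2 - X 2 * Y 1) * hc 1 2
    + (X 1 * Y 3 - X 3 * Y 1) * hc 1 3 + (X 2 * Y 3 - X 3 * Y 2) * hc 2 3

lemma chart_one {η : Pt → Pt →L[ℝ] ℝ} {p q : Pt → ℝ} {x₀ : Pt} (S : Set Pt) (hS : S ∈ 𝓝 x₀)
    (hp : ∀ᶠ x in 𝓝 x₀, ContDiffAt ℝ ∞ p x) (hq : ∀ᶠ x in 𝓝 x₀, ContDiffAt ℝ ∞ q x)
    (hp0 : p x₀ = 1) (hq0 : q x₀ = 0)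
    (h : ∀ᶠ x in 𝓝 x₀, η x = p x • fderiv ℝ q x) (X Y : Pt) (hXY : dform η x₀ X Y ≠ 0) :
    ∃ e : OpenPartialHomeomorph Pt Pt, x₀ ∈ e.source ∧ e.source ⊆ S ∧ e x₀ = 0 ∧
      (∀ x ∈ e.source, ContDiffAt ℝ ∞ e x) ∧ (∀ y ∈ e.target, ContDiffAt ℝ ∞ e.symm y) ∧
      ∀ x ∈ e.source, ∀ v, η x v = (1 + e x 0) * (fderiv ℝ e x v) 2 := by
  rw [dform_pdq hp.self_of_nhds hq.self_of_nhds h] at hXY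
  obtain ⟨i, j, hij⟩ := exists_minor hXY
  have hne : i ≠ j := by
    rintro rfl
    apply hij; ring
  obtain ⟨a, b, hab⟩ : ∃ a b : Fin 4, ∀ k, k = i ∨ k = j ∨ k = a ∨ k = b := by
    clear * - hne
    revert i j
    decide
  set f : Pt → Pt := fun x => ![p x - 1, x a - x₀ a, q x, x b - x₀ b] with hf
  set D : Pt → Pt →L[ℝ] Pt := fun x => ContinuousLinearMap.pi
    ![fderiv ℝ p x, ContinuousLinearMap.proj a, fderiv ℝ q x, ContinuousLinearMap.proj b] with hD
  have hfD : ∀ x, ContDiffAt ℝ ∞ p x → ContDiffAt ℝ ∞ q x → HasFDerivAt f (D x) x := by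
    intro x h1 h2
    rw [hasFDerivAt_pi']
    intro k
    fin_cases k
    · exact (h1.differentiableAt (by simp)).hasFDerivAt.sub_const 1
    · exact (hasFDerivAt_apply (𝕜 := ℝ) a x).sub_const (x₀ a)
    · exact (h2.differentiableAt (by simp)).hasFDerivAt
    · exact (hasFDerivAt_apply (𝕜 := ℝ) b x).sub_const (x₀ b)
  have hfs : ∀ᶠ x in 𝓝 x₀, ContDiffAt ℝ ∞ f x := by
    filter_upwards [hp, hq] with x h1 h2
    rw [contDiffAt_pi]
    intro k
    fin_cases k
    · exact h1.sub contDiffAt_const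
    · exact (contDiff_apply ℝ ℝ a).contDiffAt.sub contDiffAt_const
    · exact h2
    · exact (contDiff_apply ℝ ℝ b).contDiffAt.sub contDiffAt_const
  have hinj : Function.Injective (D x₀ : Pt →ₗ[ℝ] Pt) := by
    rw [injective_iff_map_eq_zero]
    intro v hv
    have hv0 : fderiv ℝ p x₀ v = 0 := congrFun hv 0
    have hv1 : v a = 0 := congrFun hv 1
    have hv2 : fderiv ℝ q x₀ v = 0 := congrFun hv 2
    have hv3 : v b = 0 := congrFun hv 3
    have hv4 : v = v i • Pi.single i 1 + v j • Pi.single j 1 := by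
      ext k
      by_cases hki : k = i
      · subst hki; simp [hne]
      by_cases hkj : k = j
      · subst hkj; simp [hki]
      · have : v k = 0 := by
          rcases hab k with h | h | h | h
          · exact absurd h hki
          · exact absurd h hkj
          · rw [h, hv1]
          · rw [h, hv3]
        simp [this, hki, hkj]
    rw [hv4] at hv0 hv2
    simp only [map_add, map_smul, smul_eq_mul] at hv0 hv2
    change v i * pd i p x₀ + v j * pd j p x₀ = 0 at hv0
    change v i * pd i q x₀ + v j * pd j q x₀ = 0 at hv2
    have hi : v i = 0 := by
      refine (mul_eq_zero.1 (?_ : v i * _ = 0)).resolve_right hij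
      linear_combination pd j q x₀ * hv0 - pd j p x₀ * hv2
    have hj : v j = 0 := by
      refine (mul_eq_zero.1 (?_ : v j * _ = 0)).resolve_right hij
      linear_combination pd i p x₀ * hv2 - pd i q x₀ * hv0
    rw [hv4, hi, hj]; simp
  set f' : Pt ≃L[ℝ] Pt := (LinearEquiv.ofInjectiveEndo _ hinj).toContinuousLinearEquiv with hf'
  have hf'D : HasFDerivAt f (f' : Pt →L[ℝ] Pt) x₀ := by
    have : (f' : Pt →L[ℝ] Pt) = D x₀ := by ext v; rfl
    rw [this]
    exact hfD x₀ hp.self_of_nhds hq.self_of_nhds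
  obtain ⟨e, he, hx0, hsub, hs1, hs2⟩ := inv_fun f x₀
    (S ∩ {x | ContDiffAt ℝ ∞ p x ∧ ContDiffAt ℝ ∞ q x ∧ η x = p x • fderiv ℝ q x})
    (inter_mem hS (hp.and (hq.and h))) hfs f' hf'D
  have hef : (e : Pt → Pt) = f := funext he
  refine ⟨e, hx0, fun x hx => (hsub hx).1, ?_, ?_, hs2, ?_⟩
  · rw [hef, hf]
    ext k
    fin_cases k <;> simp [hp0, hq0]
  · rw [hef]; exact hs1
  · intro x hx v
    obtain ⟨h1, h2, h3⟩ := (hsub hx).2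
    rw [hef, (hfD x h1 h2).fderiv, h3]
    simp [hf, hD]

end ChartOne

end Part8

section Part9
open Real Filter
open scoped ContDiff Topology

section MainLocal

lemma pd_congr_nhds {f g : Pt → ℝ} {u : Pt} (h : f =ᶠ[𝓝 u] g) (i : Fin 4) : pd i f u = pd i g u := by
  unfold pd
  rw [h.fderiv_eq]

lemma bil_expand (T : Pt →L[ℝ] Pt →L[ℝ] ℝ) (V W : Pt) :
    T V W = ∑ i, ∑ j, V i * W j * T (Pi.single i 1) (Pi.single j 1) := by
  conv_lhs => rw [pi_eq_sum_univ' V, pi_eq_sum_univ' W]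
  simp only [map_sum, map_smul, sum_apply, smul_apply, smul_eq_mul, Finset.mul_sum]
  rw [Finset.sum_comm]
  refine Finset.sum_congr rfl fun i _ => Finset.sum_congr rfl fun j _ => ?_
  ring

lemma main_local (B : Pt → Pt →L[ℝ] Pt →L[ℝ] ℝ) (η : Pt → Pt →L[ℝ] ℝ) (x₀ : Pt)
    (e : OpenPartialHomeomorph Pt Pt) (hx0 : x₀ ∈ e.source) (he0 : e x₀ = 0)
    (hs1 : ∀ x ∈ e.source, ContDiffAt ℝ ∞ e x) (hs2 : ∀ y ∈ e.target, ContDiffAt ℝ ∞ e.symm y)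
    (hη : ∀ x ∈ e.source, ∀ v, η x v = (1 + e x 0) * (fderiv ℝ e x v) 2)
    (hB : ∀ x ∈ e.source, ContDiffAt ℝ ∞ B x)
    (halt : ∀ x ∈ e.source, ∀ v w, B x v w = - B x w v)
    (hD : ∀ x ∈ e.source, ∀ X Y Z,
      D3 B x X Y Z = η x X * B x Y Z - η x Y * B x X Z + η x Z * B x X Y) :
    ∃ Ψ : Pt → Pt, (∀ᶠ x in 𝓝 x₀, ContDiffAt ℝ ∞ Ψ x) ∧ Ψ x₀ = 0 ∧
      ∀ᶠ x in 𝓝 x₀, ∀ v w, B x v w =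
        rexp ((1 + Ψ x 0) * Ψ x 2) * (fderiv ℝ Ψ x v 0 * fderiv ℝ Ψ x w 1
          - fderiv ℝ Ψ x v 1 * fderiv ℝ Ψ x w 0)
        + (fderiv ℝ Ψ x v 2 * fderiv ℝ Ψ x w 3 - fderiv ℝ Ψ x v 3 * fderiv ℝ Ψ x w 2) := by
  set φ : Pt → Pt := ⇑e.symm with hφ
  set β : Fin 4 → Fin 4 → Pt → ℝ := fun i j u =>
    B (φ u) (fderiv ℝ φ u (Pi.single i 1)) (fderiv ℝ φ u (Pi.single j 1)) with hβ
  have ht0 : (0 : Pt) ∈ e.target := by rw [← he0]; exact e.map_source hx0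
  have hφs : ∀ u ∈ e.target, φ u ∈ e.source := fun u hu => e.map_target hu
  have hβs : ∀ i j, ∀ u ∈ e.target, ContDiffAt ℝ ∞ (β i j) u := by
    intro i j u hu
    have h1 : ContDiffAt ℝ ∞ (fun y => B (φ y)) u :=
      ContDiffAt.comp (g := B) u (hB _ (hφs u hu)) (hs2 u hu)
    have h2 : ContDiffAt ℝ ∞ (fderiv ℝ φ) u := (hs2 u hu).fderiv_right (by simp)
    exact (h1.clm_apply (h2.clm_apply contDiffAt_const)).clm_apply (h2.clm_apply contDiffAt_const)
  have hchain : ∀ u ∈ e.target, ∀ v, fderiv ℝ e (φ u) (fderiv ℝ φ u v) = v := by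
    intro u hu v
    have h1 : HasFDerivAt (fun y => e (φ y)) ((fderiv ℝ e (φ u)).comp (fderiv ℝ φ u)) u :=
      HasFDerivAt.comp (g := e) u
        ((hs1 _ (hφs u hu)).differentiableAt (by simp)).hasFDerivAt
        ((hs2 u hu).differentiableAt (by simp)).hasFDerivAt
    have h2 : (fun y => e (φ y)) =ᶠ[𝓝 u] id := by
      filter_upwards [e.open_target.mem_nhds hu] with y hy
      exact e.right_inv hy
    have h3 := h1.unique ((hasFDerivAt_id u).congr_of_eventuallyEq h2)
    exact congrArg (fun T : Pt →L[ℝ] Pt => T v) h3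
  have hchain2 : ∀ x ∈ e.source, ∀ v, fderiv ℝ φ (e x) (fderiv ℝ e x v) = v := by
    intro x hx v
    have h1 : HasFDerivAt (fun y => φ (e y)) ((fderiv ℝ φ (e x)).comp (fderiv ℝ e x)) x :=
      HasFDerivAt.comp (g := φ) x
        ((hs2 _ (e.map_source hx)).differentiableAt (by simp)).hasFDerivAt
        ((hs1 x hx).differentiableAt (by simp)).hasFDerivAt
    have h2 : (fun y => φ (e y)) =ᶠ[𝓝 x] id := by
      filter_upwards [e.open_source.mem_nhds hx] with y hy
      exact e.left_inv hy
    have h3 := h1.unique ((hasFDerivAt_id x).congr_of_eventuallyEq h2)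
    exact congrArg (fun T : Pt →L[ℝ] Pt => T v) h3
  have hE : ∀ u ∈ e.target, ∀ i j k, pd i (β j k) u - pd j (β i k) u + pd k (β i j) u =
      (1 + u 0) * (Pi.single i 1 : Pt) 2 * β j k u - (1 + u 0) * (Pi.single j 1 : Pt) 2 * β i k u
      + (1 + u 0) * (Pi.single k 1 : Pt) 2 * β i j u := by
    intro u hu i j k
    have h1 := pullback_D3 B φ u (hs2 u hu) ((hB _ (hφs u hu)).differentiableAt (by simp))
      (halt _ (hφs u hu)) (Pi.single i 1) (Pi.single j 1) (Pi.single k 1)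
    rw [hD _ (hφs u hu)] at h1
    simp only [hη _ (hφs u hu), hchain u hu] at h1
    rw [show e (φ u) = u from e.right_inv hu] at h1
    exact h1
  have hext : ∀ i j, ∃ g, ContDiff ℝ ∞ g ∧ g =ᶠ[𝓝 (0 : Pt)] β i j := fun i j =>
    exists_ext (β i j) 0 (by
      filter_upwards [e.open_target.mem_nhds ht0] with u hu
      exact hβs i j u hu)
  choose c hc1 hc2 using hext
  have hev : ∀ᶠ u in 𝓝 (0 : Pt), u ∈ e.target ∧ ∀ i j, c i j =ᶠ[𝓝 u] β i j := by
    have ht : ∀ᶠ u in 𝓝 (0 : Pt), u ∈ e.target := e.open_target.mem_nhds ht0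
    refine ht.and ?_
    rw [eventually_all]; intro i
    rw [eventually_all]; intro j
    exact eventually_eventually_nhds.2 (hc2 i j)
  obtain ⟨r, hr, hball⟩ := Metric.mem_nhds_iff.1 hev
  have hEc : ∀ u ∈ Metric.ball (0 : Pt) r, ∀ i j k,
      pd i (c j k) u - pd j (c i k) u + pd k (c i j) u =
      (1 + u 0) * (Pi.single i 1 : Pt) 2 * c j k u - (1 + u 0) * (Pi.single j 1 : Pt) 2 * c i k u
      + (1 + u 0) * (Pi.single k 1 : Pt) 2 * c i j u := by
    intro u hu i j k
    obtain ⟨h1, h2⟩ := hball hu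
    rw [pd_congr_nhds (h2 j k), pd_congr_nhds (h2 i k), pd_congr_nhds (h2 i j),
      (h2 j k).self_of_nhds, (h2 i k).self_of_nhds, (h2 i j).self_of_nhds]
    exact hE u h1 i j k
  obtain ⟨X, Y, hX, hY, hX0, hY0, hXY⟩ := adapted_normal_form (c 0 1) (c 0 2) (c 0 3) (c 1 2) (c 1 3)
    (c 2 3) (hc1 _ _) (hc1 _ _) (hc1 _ _) (hc1 _ _) (hc1 _ _) (hc1 _ _) r
    (fun u hu => by rw [hEc u hu 0 1 2]; simp)
    (fun u hu => by rw [hEc u hu 0 1 3]; simp)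
    (fun u hu => by rw [hEc u hu 0 2 3]; simp)
    (fun u hu => by rw [hEc u hu 1 2 3]; simp)
  set Ψ : Pt → Pt := fun x => ![e x 0, X (e x), e x 2, Y (e x)] with hΨ
  have hΨd : ∀ x ∈ e.source, HasFDerivAt Ψ (ContinuousLinearMap.pi
      ![(ContinuousLinearMap.proj 0).comp (fderiv ℝ e x), (fderiv ℝ X (e x)).comp (fderiv ℝ e x),
        (ContinuousLinearMap.proj 2).comp (fderiv ℝ e x),
        (fderiv ℝ Y (e x)).comp (fderiv ℝ e x)]) x := by
    intro x hx
    have hed : HasFDerivAt e (fderiv ℝ e x) x := ((hs1 x hx).differentiableAt (by simp)).hasFDerivAt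
    rw [hasFDerivAt_pi']
    intro k
    fin_cases k
    · have h := (hasFDerivAt_apply (𝕜 := ℝ) (0 : Fin 4) (e x)).comp x hed
      exact h
    · have h := HasFDerivAt.comp (g := X) x (hX.differentiable (by simp) _).hasFDerivAt hed
      exact h
    · have h := (hasFDerivAt_apply (𝕜 := ℝ) (2 : Fin 4) (e x)).comp x hed
      exact h
    · have h := HasFDerivAt.comp (g := Y) x (hY.differentiable (by simp) _).hasFDerivAt hed
      exact h
  refine ⟨Ψ, ?_, ?_, ?_⟩
  · filter_upwards [e.open_source.mem_nhds hx0] with x hx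
    rw [contDiffAt_pi]
    intro k
    fin_cases k
    · exact contDiffAt_pi.1 (hs1 x hx) 0
    · exact ContDiffAt.comp (g := X) x hX.contDiffAt (hs1 x hx)
    · exact contDiffAt_pi.1 (hs1 x hx) 2
    · exact ContDiffAt.comp (g := Y) x hY.contDiffAt (hs1 x hx)
  · ext k
    fin_cases k <;> simp [hΨ, he0, hX0, hY0]
  · have hcont : ∀ᶠ x in 𝓝 x₀, e x ∈ Metric.ball (0 : Pt) r := by
      have := (hs1 x₀ hx0).continuousAt
      apply this
      rw [he0]
      exact Metric.ball_mem_nhds 0 hr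
    filter_upwards [e.open_source.mem_nhds hx0, hcont] with x hx hxr v w
    obtain ⟨hut, hcβ⟩ := hball hxr
    have hcβ' : ∀ i j, c i j (e x) = β i j (e x) := fun i j => (hcβ i j).self_of_nhds
    have hβa : ∀ i j, β i j (e x) = - β j i (e x) := fun i j => halt _ (hφs _ hut) _ _
    have hexp : B x v w = ∑ i, ∑ j, fderiv ℝ e x v i * fderiv ℝ e x w j * β i j (e x) := by
      have h1 := bil_expand (((B x).bilinearComp (fderiv ℝ φ (e x)) (fderiv ℝ φ (e x))))
        (fderiv ℝ e x v) (fderiv ℝ e x w)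
      simp only [ContinuousLinearMap.bilinearComp_apply, hchain2 x hx] at h1
      rw [h1]
      simp only [hβ]
      rw [show φ (e x) = x from e.left_inv hx]
    rw [hexp, (hΨd x hx).fderiv]
    obtain ⟨k1, k2, k3, k4, k5, k6⟩ := hXY (e x) hxr
    rw [hcβ'] at k1 k2 k3 k4 k5 k6
    have z0 : β 0 0 (e x) = 0 := by linarith [hβa 0 0]
    have z1 : β 1 1 (e x) = 0 := by linarith [hβa 1 1]
    have z2 : β 2 2 (e x) = 0 := by linarith [hβa 2 2]
    have z3 : β 3 3 (e x) = 0 := by linarith [hβa 3 3]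
    simp only [Fin.sum_univ_four, z0, z1, z2, z3, hβa 1 0, hβa 2 0, hβa 3 0, hβa 2 1, hβa 3 1,
      hβa 3 2, k1, k2, k3, k4, k5, k6]
    simp [hΨ, fderiv_eq_sum, Fin.sum_univ_four]
    ring

end MainLocal

end Part9

section Part10
open Real Filter
open scoped ContDiff Topology

section Final

lemma pf_zero (M : Fin 4 → Fin 4 → ℝ) (ha : ∀ i j, M i j = - M j i)
    (h : M 0 1 * M 2 3 - M 0 2 * M 1 3 + M 0 3 * M 1 2 = 0) (i j k l : Fin 4) :
    M i j * M k l - M i k * M j l + M i l * M j k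
    + M j k * M i l - M j l * M i k + M k l * M i j = 0 := by
  have z0 : M 0 0 = 0 := by linarith [ha 0 0]
  have z1 : M 1 1 = 0 := by linarith [ha 1 1]
  have z2 : M 2 2 = 0 := by linarith [ha 2 2]
  have z3 : M 3 3 = 0 := by linarith [ha 3 3]
  have h10 := ha 1 0
  have h20 := ha 2 0
  have h30 := ha 3 0
  have h21 := ha 2 1
  have h31 := ha 3 1
  have h32 := ha 3 2
  clear ha
  fin_cases i <;> fin_cases j <;> fin_cases k <;> fin_cases l <;>
    simp only [Fin.zero_eta, Fin.mk_one, Fin.reduceFinMk, z0, z1, z2, z3, h10, h20, h30,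
      h21, h31, h32] <;>
    first
      | ring1
      | linear_combination 2 * h
      | linear_combination (-2) * h

lemma nondeg (M : Fin 4 → Fin 4 → ℝ) (ha : ∀ i j, M i j = - M j i)
    (h : M 0 1 * M 2 3 - M 0 2 * M 1 3 + M 0 3 * M 1 2 ≠ 0) (v : Pt)
    (hv : ∀ w, b2 M v w = 0) : v = 0 := by
  have z0 : M 0 0 = 0 := by linarith [ha 0 0]
  have z1 : M 1 1 = 0 := by linarith [ha 1 1]
  have z2 : M 2 2 = 0 := by linarith [ha 2 2]
  have z3 : M 3 3 = 0 := by linarith [ha 3 3]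
  have E0 := hv (Pi.single 0 1)
  have E1 := hv (Pi.single 1 1)
  have E2 := hv (Pi.single 2 1)
  have E3 := hv (Pi.single 3 1)
  simp [b2_apply, Fin.sum_univ_four, z0, z1, z2, z3, ha 1 0, ha 2 0, ha 3 0, ha 2 1, ha 3 1,
    ha 3 2] at E0 E1 E2 E3
  ext k
  refine (mul_eq_zero.1 (?_ : v k * _ = 0)).resolve_right h
  fin_cases k
  · simp only [Fin.zero_eta]
    linear_combination M 2 3 * E1 - M 1 3 * E2 + M 1 2 * E3
  · simp only [Fin.mk_one]
    linear_combination (-M 2 3) * E0 + M 0 3 * E2 - M 0 2 * E3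
  · simp only [Fin.reduceFinMk]
    linear_combination M 1 3 * E0 - M 0 3 * E1 + M 0 1 * E3
  · simp only [Fin.reduceFinMk]
    linear_combination (-M 1 2) * E0 + M 0 2 * E1 - M 0 1 * E2

lemma dxw_single (a b i j : Fin 4) :
    (Pi.single i 1 : Pt) a * (Pi.single j 1 : Pt) b - (Pi.single i 1 : Pt) b * (Pi.single j 1 : Pt) a
      = dxw a b i j := by
  have h : ∀ m n : Fin 4, (Pi.single m 1 : Pt) n = if m = n then 1 else 0 := by
    intro m n
    rw [Pi.single_apply]
    by_cases h : m = n
    · simp [h]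
    · simp [h, Ne.symm h]
  simp only [h, dxw, ite_and]
  split_ifs <;> simp

lemma pull2_eq (φ : Pt → Pt) (Ω : Form2) (u : Pt) (hφ : DifferentiableAt ℝ φ u) (i j : Fin 4) :
    pull2 φ Ω u i j = b2 (Ω (φ u)) (fderiv ℝ φ u (Pi.single i 1)) (fderiv ℝ φ u (Pi.single j 1)) := by
  have h : ∀ i a, pd i (fun y => φ y a) u = fderiv ℝ φ u (Pi.single i 1) a := by
    intro i a
    unfold pd
    rw [(hasFDerivAt_pi'.1 hφ.hasFDerivAt a).fderiv]
    rfl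
  rw [b2_apply]
  unfold pull2
  simp only [h, mul_assoc]

lemma final_chart (W : Set Pt) (hW : IsOpen W) (x₀ : Pt) (hx₀ : x₀ ∈ W) (Ω : Form2)
    (hΩa : ∀ i j, Ω x₀ i j = - Ω x₀ j i) (hΩr : w22 Ω Ω x₀ ≠ 0)
    (Ψ : Pt → Pt) (hΨ : ∀ᶠ x in 𝓝 x₀, ContDiffAt ℝ ∞ Ψ x) (hΨ0 : Ψ x₀ = 0)
    (hid : ∀ᶠ x in 𝓝 x₀, ∀ v w, b2 (Ω x) v w =
        rexp ((1 + Ψ x 0) * Ψ x 2) * (fderiv ℝ Ψ x v 0 * fderiv ℝ Ψ x w 1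
          - fderiv ℝ Ψ x v 1 * fderiv ℝ Ψ x w 0)
        + (fderiv ℝ Ψ x v 2 * fderiv ℝ Ψ x w 3 - fderiv ℝ Ψ x v 3 * fderiv ℝ Ψ x w 2)) :
    ∃ (U V : Set Pt) (φ ψ : Pt → Pt),
      IsOpen U ∧ IsOpen V ∧ (0 : Pt) ∈ U ∧ x₀ ∈ V ∧ V ⊆ W ∧ φ 0 = x₀ ∧
      Set.MapsTo φ U V ∧ Set.MapsTo ψ V U ∧
      (∀ u ∈ U, ψ (φ u) = u) ∧ (∀ y ∈ V, φ (ψ y) = y) ∧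
      ContDiffOn ℝ (⊤ : ℕ∞) φ U ∧ ContDiffOn ℝ (⊤ : ℕ∞) ψ V ∧
      ∀ u ∈ U, ∀ i j, pull2 φ Ω u i j =
        Real.exp ((1 + u 0) * u 2) * dxw 0 1 i j + dxw 2 3 i j := by
  have hpf : Ω x₀ 0 1 * Ω x₀ 2 3 - Ω x₀ 0 2 * Ω x₀ 1 3 + Ω x₀ 0 3 * Ω x₀ 1 2 ≠ 0 := by
    intro h
    apply hΩr
    funext i j k l
    exact pf_zero (Ω x₀) hΩa h i j k l
  have hinj : Function.Injective (fderiv ℝ Ψ x₀ : Pt →ₗ[ℝ] Pt) := by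
    rw [injective_iff_map_eq_zero]
    intro v hv
    have hv' : fderiv ℝ Ψ x₀ v = 0 := hv
    refine nondeg (Ω x₀) hΩa hpf v fun w => ?_
    rw [hid.self_of_nhds v w, hv']
    simp
  set f' : Pt ≃L[ℝ] Pt := (LinearEquiv.ofInjectiveEndo _ hinj).toContinuousLinearEquiv with hf'
  have hf'D : HasFDerivAt Ψ (f' : Pt →L[ℝ] Pt) x₀ := by
    have : (f' : Pt →L[ℝ] Pt) = fderiv ℝ Ψ x₀ := by ext v; rfl
    rw [this]
    exact (hΨ.self_of_nhds.differentiableAt (by simp)).hasFDerivAt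
  obtain ⟨e, he, hx0, hsub, hs1, hs2⟩ := inv_fun Ψ x₀ (W ∩ {x | _})
    (inter_mem (hW.mem_nhds hx₀) hid) hΨ f' hf'D
  have he0 : e x₀ = 0 := by rw [he, hΨ0]
  refine ⟨e.target, e.source, e.symm, Ψ, e.open_target, e.open_source, ?_, hx0,
    fun x hx => (hsub hx).1, ?_, fun u hu => e.map_target hu, fun x hx => ?_, fun u hu => ?_,
    fun y hy => ?_, fun u hu => (hs2 u hu).contDiffWithinAt,
    fun x hx => (hs1 x hx).contDiffWithinAt, fun u hu i j => ?_⟩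
  · rw [← he0]; exact e.map_source hx0
  · rw [← he0]; exact e.left_inv hx0
  · rw [← he]; exact e.map_source hx
  · rw [← he]; exact e.right_inv hu
  · rw [← he]; exact e.left_inv hy
  · have hφd := (hs2 u hu).differentiableAt (by simp)
    have hsrc := e.map_target hu
    have hchain : ∀ v, fderiv ℝ Ψ (e.symm u) (fderiv ℝ e.symm u v) = v := by
      intro v
      have h1 : HasFDerivAt (fun y => Ψ (e.symm y))
          ((fderiv ℝ Ψ (e.symm u)).comp (fderiv ℝ e.symm u)) u :=
        HasFDerivAt.comp (g := Ψ) u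
          ((hs1 _ hsrc).differentiableAt (by simp)).hasFDerivAt hφd.hasFDerivAt
      have h2 : (fun y => Ψ (e.symm y)) =ᶠ[𝓝 u] id := by
        filter_upwards [e.open_target.mem_nhds hu] with y hy
        rw [← he]
        exact e.right_inv hy
      have h3 := h1.unique ((hasFDerivAt_id u).congr_of_eventuallyEq h2)
      exact congrArg (fun T : Pt →L[ℝ] Pt => T v) h3
    have hidu := (hsub hsrc).2
    simp only [Set.mem_ofPred_eq] at hidu
    rw [pull2_eq _ _ _ hφd, hidu, hchain, hchain, dxw_single, dxw_single, ← he, e.right_inv hu]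

theorem type2_aux (W : Set Pt) (hW : IsOpen W) (x₀ : Pt) (hx₀ : x₀ ∈ W)
    (Ω : Form2) (hΩs : ContDiffOn ℝ (⊤ : ℕ∞) Ω W)
    (hΩa : ∀ x ∈ W, ∀ i j, Ω x i j = - Ω x j i)
    (hΩr : ∀ x ∈ W, w22 Ω Ω x ≠ 0)
    (w : Form1) (hws : ContDiffOn ℝ (⊤ : ℕ∞) w W)
    (hw : ∀ x ∈ W, w12 w Ω x = d2 Ω x)
    (htype : IsTypeAt w 2 x₀) :
    ∃ (U V : Set Pt) (φ ψ : Pt → Pt),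
      IsOpen U ∧ IsOpen V ∧ (0 : Pt) ∈ U ∧ x₀ ∈ V ∧ V ⊆ W ∧ φ 0 = x₀ ∧
      Set.MapsTo φ U V ∧ Set.MapsTo ψ V U ∧
      (∀ u ∈ U, ψ (φ u) = u) ∧ (∀ y ∈ V, φ (ψ y) = y) ∧
      ContDiffOn ℝ (⊤ : ℕ∞) φ U ∧ ContDiffOn ℝ (⊤ : ℕ∞) ψ V ∧
      ∀ u ∈ U, ∀ i j, pull2 φ Ω u i j =
        Real.exp ((1 + u 0) * u 2) * dxw 0 1 i j + dxw 2 3 i j := by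
  have hWn : ∀ᶠ x in 𝓝 x₀, x ∈ W := hW.mem_nhds hx₀
  have hΩc : ∀ x ∈ W, ContDiffAt ℝ ∞ Ω x := fun x hx => hΩs.contDiffAt (hW.mem_nhds hx)
  have hwc : ∀ x ∈ W, ContDiffAt ℝ ∞ w x := fun x hx => hws.contDiffAt (hW.mem_nhds hx)
  obtain ⟨hw0, hclass⟩ := htype
  obtain ⟨η', hη's, hη'e⟩ := exists_ext (fun y => b1 (w y)) x₀ (by
    filter_upwards [hWn] with x hx
    exact b1_contDiff.contDiffAt.comp x (hwc x hx))
  have hb0 : b1 (w x₀) ≠ 0 := by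
    intro h
    apply hw0
    ext i
    have := congrArg (fun T : Pt →L[ℝ] ℝ => T (Pi.single i 1)) h
    simpa [b1_apply, Pi.single_apply] using this
  have hη'0 : η' x₀ ≠ 0 := by rw [hη'e.self_of_nhds]; exact hb0
  have hInt : ∀ᶠ x in 𝓝 x₀, Integ η' x := by
    filter_upwards [hWn, hclass, eventually_eventually_nhds.2 hη'e] with x hx hc he
    have := integ_of_class ((hwc x hx).differentiableAt (by simp)) hc
    have he' : η' =ᶠ[𝓝 x] fun y => b1 (w y) := he
    intro X Y Z
    have h2 := this X Y Z
    unfold dform at h2 ⊢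
    rw [he'.fderiv_eq, he'.self_of_nhds]
    exact h2
  obtain ⟨p, q, hp, hq, hp0, hq0, hpq⟩ := frob_main η' hη's x₀ hη'0 hInt
  have hpq' : ∀ᶠ x in 𝓝 x₀, b1 (w x) = p x • fderiv ℝ q x := by
    filter_upwards [hpq, hη'e] with x h1 h2
    rw [← h1, h2]
  obtain ⟨X, Y, hXY⟩ := dform_ne_of_class ((hwc x₀ hx₀).differentiableAt (by simp))
    hclass.self_of_nhds
  obtain ⟨e, hx0, hsub, he0, hs1, hs2, hη⟩ := chart_one (η := fun y => b1 (w y)) W hWn hp hq hp0 hq0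
    hpq' X Y hXY
  obtain ⟨Ψ, h1, h2, h3⟩ := main_local (fun y => b2 (Ω y)) (fun y => b1 (w y)) x₀ e hx0 he0 hs1 hs2 hη
    (fun x hx => b2_contDiff.contDiffAt.comp x (hΩc x (hsub hx)))
    (fun x hx v u => by
      rw [b2_apply, b2_apply, Finset.sum_comm, ← Finset.sum_neg_distrib]
      refine Finset.sum_congr rfl fun i _ => ?_
      rw [← Finset.sum_neg_distrib]
      refine Finset.sum_congr rfl fun j _ => ?_
      rw [hΩa x (hsub hx) j i]; ring)
    (fun x hx X Y Z => by
      rw [D3_eq ((hΩc x (hsub hx)).differentiableAt (by simp)), ← hw x (hsub hx), w12_eq])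
  exact final_chart W hW x₀ hx₀ Ω (hΩa x₀ hx₀) (hΩr x₀ hx₀) Ψ h1 h2 h3

end Final

end Part10

/-- Theorem `type2`. A germ of a rank-4 2-form of type 2 at `x₀` has,
in suitable local coordinates centred at `x₀`, the normal form
`Ω = exp((1+x¹)x³) dx¹∧dx² + dx³∧dx⁴`. -/
theorem type2_normal_form (W : Set Pt) (hW : IsOpen W) (x₀ : Pt) (hx₀ : x₀ ∈ W)
    (Ω : Form2) (hΩs : ContDiffOn ℝ (⊤ : ℕ∞) Ω W)
    (hΩa : ∀ x ∈ W, ∀ i j, Ω x i j = - Ω x j i)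
    (hΩr : ∀ x ∈ W, w22 Ω Ω x ≠ 0)
    (ω : Form1) (hωs : ContDiffOn ℝ (⊤ : ℕ∞) ω W)
    (hω : ∀ x ∈ W, w12 ω Ω x = d2 Ω x)
    (htype : IsTypeAt ω 2 x₀) :
    ∃ (U V : Set Pt) (φ ψ : Pt → Pt),
      IsOpen U ∧ IsOpen V ∧ (0 : Pt) ∈ U ∧ x₀ ∈ V ∧ V ⊆ W ∧ φ 0 = x₀ ∧
      Set.MapsTo φ U V ∧ Set.MapsTo ψ V U ∧
      (∀ u ∈ U, ψ (φ u) = u) ∧ (∀ y ∈ V, φ (ψ y) = y) ∧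
      ContDiffOn ℝ (⊤ : ℕ∞) φ U ∧ ContDiffOn ℝ (⊤ : ℕ∞) ψ V ∧
      ∀ u ∈ U, ∀ i j, pull2 φ Ω u i j =
        Real.exp ((1 + u 0) * u 2) * dxw 0 1 i j + dxw 2 3 i j := by
  exact type2_aux W hW x₀ hx₀ Ω hΩs hΩa hΩr ω hωs hω htype
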